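/- arXiv:2211.08729 — 2 statements merged into one kernel-verified Lean document; each statement's English description precedes it below -/
import Mathlib

section
/- Let f be an integral binary form of degree N with nonzero discriminant, and for each prime p choose a pair (A_p, B_p) ∈ W_N^0(ℤ_p) with inv(A_p, B_p) = f. Then there exists a pair (A, B) ∈ W_N^0(ℤ), unique up to the action of G_N(ℤ), such that for every prime p the pair (A, B) (viewed in W_N^0(ℤ_p)) is G_N(ℤ_p)-equivalent to (A_p, B_p). -/
open Matrix MvPolynomial

/-- Pairs of `N × N` matrices over `R`, with `N = 2n+1`. -/
abbrev MPair (n : ℕ) (R : Type*) : Type _ :=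
  Matrix (Fin (2*n+1)) (Fin (2*n+1)) R × Matrix (Fin (2*n+1)) (Fin (2*n+1)) R

/-- The action of a matrix `g` on a pair: `g • (A, B) = (g A gᵀ, g B gᵀ)`. -/
def actPair {R : Type*} [CommRing R] {m : ℕ} (g : Matrix (Fin m) (Fin m) R)
    (w : Matrix (Fin m) (Fin m) R × Matrix (Fin m) (Fin m) R) :
    Matrix (Fin m) (Fin m) R × Matrix (Fin m) (Fin m) R :=
  (g * w.1 * g.transpose, g * w.2 * g.transpose)

/-- Membership in `W_N(R)`: both matrices are symmetric. -/
def WNmem {R : Type*} [CommRing R] (n : ℕ) (w : MPair n R) : Prop := w.1.IsSymm ∧ w.2.IsSymm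

/-- The inclusion `Fin n → Fin (2n+1)` of the first `n` indices. -/
def rowIdx (n : ℕ) (i : Fin n) : Fin (2*n+1) := Fin.castLE (by omega) i

/-- The inclusion `Fin (n+1) → Fin (2n+1)` of the last `n+1` indices. -/
def colIdx (n : ℕ) (j : Fin (n+1)) : Fin (2*n+1) :=
  Fin.cast (by omega) (Fin.natAdd n j)

/-- The coefficient of `x^{N-i} y^i` in a binary `N`-ic form (written in
`MvPolynomial (Fin 2) R`, where variable `0` is `x` and variable `1` is `y`). -/
noncomputable def formCoeff {R : Type*} [CommRing R] (f : MvPolynomial (Fin 2) R) (N i : ℕ) : R :=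
  MvPolynomial.coeff (Finsupp.single (0 : Fin 2) (N - i) + Finsupp.single (1 : Fin 2) i) f

/-- The `λ`-invariant of a pair `(A,B)`, computed from the top-right `n × (n+1)` blocks:
the determinant of the `(n+1) × (n+1)` matrix whose `(i,j)` entry (0-indexed) is `(-1)^i`
times the coefficient of `x^{n-j} y^j` in `det(x A^{(i)} - y B^{(i)})`, where `A^{(i)}`,
`B^{(i)}` are obtained from the top-right `n × (n+1)` blocks by deleting the `i`-th column. -/
noncomputable def lambdaInv {R : Type*} [CommRing R] (n : ℕ) (w : MPair n R) : R :=
  Matrix.det (Matrix.of fun i j : Fin (n+1) =>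
    (-1 : R) ^ (i : ℕ) *
      formCoeff
        (Matrix.det (Matrix.of fun r c : Fin n =>
          MvPolynomial.X 0 * MvPolynomial.C (w.1 (rowIdx n r) (colIdx n (i.succAbove c))) -
          MvPolynomial.X 1 * MvPolynomial.C (w.2 (rowIdx n r) (colIdx n (i.succAbove c)))))
        n (j : ℕ))
/-- Membership in `W_N^0(R)`: symmetric pairs vanishing on the top-left `n × n` block. -/
def W0mem {R : Type*} [CommRing R] (n : ℕ) (w : MPair n R) : Prop :=
  WNmem n w ∧ ∀ i j : Fin (2*n+1), (i : ℕ) < n → (j : ℕ) < n → w.1 i j = 0 ∧ w.2 i j = 0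

/-- Membership in `G_N(R) ⊆ SL_N(R)`: determinant one and vanishing top-right `n × (n+1)`
block (1-indexed: `g_{ij} = 0` whenever `i ≤ n` and `j ≥ n+1`). -/
def GNmem {R : Type*} [CommRing R] (n : ℕ) (g : Matrix (Fin (2*n+1)) (Fin (2*n+1)) R) : Prop :=
  g.det = 1 ∧ ∀ i j : Fin (2*n+1), (i : ℕ) < n → n ≤ (j : ℕ) → g i j = 0

/-- `inv(A,B) = (-1)^n det(x A - y B)`, a binary `N`-ic form realized in
`MvPolynomial (Fin 2) R` (variable `0` is `x`, variable `1` is `y`). -/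
noncomputable def invForm {R : Type*} [CommRing R] (n : ℕ) (w : MPair n R) :
    MvPolynomial (Fin 2) R :=
  (-1) ^ n *
    Matrix.det (Matrix.of fun i j : Fin (2*n+1) =>
      MvPolynomial.X 0 * MvPolynomial.C (w.1 i j) - MvPolynomial.X 1 * MvPolynomial.C (w.2 i j))

/-- Entrywise application of a ring homomorphism to a pair of matrices. -/
def mapPair {R S : Type*} [CommRing R] [CommRing S] {n : ℕ} (φ : R →+* S) (w : MPair n R) :
    MPair n S :=
  (w.1.map φ, w.2.map φ)

namespace LocalGlobal

section MinorVec

variable {R : Type*} {n : ℕ}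

/-- The square matrix obtained by putting the row `w` on top of `M`. -/
def rowCons (w : Fin (n+1) → R) (M : Matrix (Fin n) (Fin (n+1)) R) :
    Matrix (Fin (n+1)) (Fin (n+1)) R :=
  Matrix.of (Fin.cons w M : Fin (n+1) → Fin (n+1) → R)

@[simp] lemma rowCons_zero (w : Fin (n+1) → R) (M : Matrix (Fin n) (Fin (n+1)) R) :
    rowCons w M 0 = w := rfl

@[simp] lemma rowCons_succ (w : Fin (n+1) → R) (M : Matrix (Fin n) (Fin (n+1)) R) (i : Fin n) :
    rowCons w M i.succ = M i := rfl

variable [CommRing R]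

/-- The vector of signed maximal minors of an `n × (n+1)` matrix. -/
def minorVec (M : Matrix (Fin n) (Fin (n+1)) R) : Fin (n+1) → R :=
  fun i => (-1) ^ (i : ℕ) * (M.submatrix id i.succAbove).det

lemma det_rowCons (w : Fin (n+1) → R) (M : Matrix (Fin n) (Fin (n+1)) R) :
    (rowCons w M).det = w ⬝ᵥ minorVec M := by
  rw [det_succ_row_zero]
  refine Finset.sum_congr rfl fun i _ => ?_
  have : (rowCons w M).submatrix Fin.succ i.succAbove = M.submatrix id i.succAbove := rfl
  rw [this, minorVec, rowCons_zero]
  ring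

lemma minorVec_map {S : Type*} [CommRing S] (φ : R →+* S) (M : Matrix (Fin n) (Fin (n+1)) R) :
    minorVec (M.map φ) = fun i => φ (minorVec M i) := by
  funext i
  simp [minorVec, RingHom.map_det, submatrix_map, RingHom.mapMatrix_apply]

lemma mulVec_minorVec (M : Matrix (Fin n) (Fin (n+1)) R) : M *ᵥ minorVec M = 0 := by
  funext i
  have h := det_rowCons (M i) M
  rw [det_zero_of_row_eq (i := 0) (j := i.succ) (Fin.succ_ne_zero i).symm (by simp)] at h
  exact h.symm

lemma rowCons_mul_right (w : Fin (n+1) → R) (M : Matrix (Fin n) (Fin (n+1)) R)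
    (k : Matrix (Fin (n+1)) (Fin (n+1)) R) :
    rowCons w M * k = rowCons (w ᵥ* k) (M * k) := by
  ext i j
  refine Fin.cases ?_ (fun i => ?_) i
  · rfl
  · rfl

lemma det_rowCons_mul_left (w : Fin (n+1) → R) (g : Matrix (Fin n) (Fin n) R)
    (M : Matrix (Fin n) (Fin (n+1)) R) :
    (rowCons w (g * M)).det = g.det * (rowCons w M).det := by
  let G : Matrix (Fin (n+1)) (Fin (n+1)) R :=
    rowCons (Pi.single 0 1) (Matrix.of fun i => (Fin.cons 0 (g i) : Fin (n+1) → R))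
  have hG : G.det = g.det := by
    rw [det_rowCons, single_one_dotProduct, minorVec]
    simp only [Fin.val_zero, pow_zero, one_mul]
    rfl
  have hmul : rowCons w (g * M) = G * rowCons w M := by
    ext i j
    refine Fin.cases ?_ (fun i => ?_) i
    · simp [G, mul_apply, Fin.sum_univ_succ, Fin.succ_ne_zero]
    · simp [G, mul_apply, Fin.sum_univ_succ]
  rw [hmul, det_mul, hG]

lemma mulVec_minorVec_mul (g : Matrix (Fin n) (Fin n) R) (M : Matrix (Fin n) (Fin (n+1)) R)
    (k : Matrix (Fin (n+1)) (Fin (n+1)) R) :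
    k *ᵥ minorVec (g * M * k) = (g.det * k.det) • minorVec M := by
  funext i
  have h : rowCons (k i) (g * M * k) = rowCons (Pi.single i 1) (g * M) * k := by
    rw [rowCons_mul_right, single_one_vecMul]; rfl
  have h2 := congrArg Matrix.det h
  rw [det_rowCons, det_mul, det_rowCons_mul_left, det_rowCons, single_one_dotProduct] at h2
  change k i ⬝ᵥ _ = _
  rw [h2, Pi.smul_apply, smul_eq_mul]
  ring

lemma adjugate_rowCons_zero (w : Fin (n+1) → R) (M : Matrix (Fin n) (Fin (n+1)) R)
    (j : Fin (n+1)) : (rowCons w M).adjugate j 0 = minorVec M j := by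
  rw [adjugate_apply]
  have : (rowCons w M).updateRow 0 (Pi.single j 1) = rowCons (Pi.single j 1) M := by
    ext a b
    refine Fin.cases ?_ (fun a => ?_) a <;> simp
  rw [this, det_rowCons, single_one_dotProduct]

/-- If `c` is orthogonal to the minors of `M`, then every multiple `minorVec M i • c` lies in the
row space of `M`. -/
lemma exists_vecMul_eq_smul (M : Matrix (Fin n) (Fin (n+1)) R) (c : Fin (n+1) → R)
    (hc : c ⬝ᵥ minorVec M = 0) (i : Fin (n+1)) :
    ∃ q : Fin n → R, q ᵥ* M = minorVec M i • c := by
  set Q := rowCons (Pi.single i 1) M with hQ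
  have hdet : Q.det = minorVec M i := by rw [hQ, det_rowCons, single_one_dotProduct]
  have hadj : ∀ j, Q.adjugate j 0 = minorVec M j := by
    intro j
    rw [hQ, adjugate_rowCons_zero]
  refine ⟨fun r => (c ᵥ* Q.adjugate) r.succ, ?_⟩
  have h : (c ᵥ* Q.adjugate) ᵥ* Q = minorVec M i • c := by
    rw [vecMul_vecMul, adjugate_mul, hdet, vecMul_smul, vecMul_one]
  have h0 : (c ᵥ* Q.adjugate) 0 = 0 := by
    rw [← hc]; simp [vecMul, dotProduct, hadj]
  rw [← h]
  funext j
  simp only [vecMul, dotProduct]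
  rw [Fin.sum_univ_succ (n := n) (f := fun x => (∑ x_1, c x_1 * Q.adjugate x_1 x) * Q x j)]
  simp only [vecMul, dotProduct] at h0
  rw [h0, zero_mul, zero_add]
  rfl

/-- If some maximal minor of `M` is a non-zero-divisor, the rows of `M` are independent. -/
lemma eq_zero_of_vecMul_rows_eq_zero [IsDomain R] (M : Matrix (Fin n) (Fin (n+1)) R) (i : Fin (n+1))
    (hi : minorVec M i ≠ 0) (q : Fin n → R) (hq : q ᵥ* M = 0) : q = 0 := by
  have h : (Fin.cons 0 q : Fin (n+1) → R) ᵥ* rowCons (Pi.single i 1) M = 0 := by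
    funext j
    have := congrFun hq j
    simpa [vecMul, dotProduct, Fin.sum_univ_succ] using this
  have h2 := Matrix.eq_zero_of_vecMul_eq_zero (by rwa [det_rowCons, single_one_dotProduct]) h
  funext j
  simpa using congrFun h2 j.succ

/-- The `n × (n+1)` matrix `[0 | I]`. -/
def shiftR (R : Type*) [CommRing R] (n : ℕ) : Matrix (Fin n) (Fin (n+1)) R :=
  Matrix.of fun i j => if j = i.succ then 1 else 0

lemma shiftR_mul {m : Type*} (N : Matrix (Fin (n+1)) m R) :
    shiftR R n * N = N.submatrix Fin.succ id := by
  ext i j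
  simp [shiftR, mul_apply]

lemma shiftR_mul_transpose : shiftR R n * (shiftR R n)ᵀ = 1 := by
  rw [shiftR_mul]
  ext i j
  simp [shiftR, one_apply]

lemma shiftR_mul_single :
    shiftR R n * (Matrix.single 0 0 1 : Matrix (Fin (n+1)) (Fin (n+1)) R) = 0 := by
  rw [shiftR_mul]
  ext i j
  simp [single, (Fin.succ_ne_zero i).symm]

lemma det_fromBlocks_shiftR :
    (fromBlocks 0 (shiftR R n) (shiftR R n)ᵀ (Matrix.single 0 0 1)).det = (-1 : R) ^ n := by
  have h1 : shiftR R n * (shiftR R n)ᵀ = 1 := shiftR_mul_transpose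
  have h2 : shiftR R n * (Matrix.single 0 0 1 : Matrix (Fin (n+1)) (Fin (n+1)) R) = 0 :=
    shiftR_mul_single
  have hmul : fromBlocks (1 : Matrix (Fin n) (Fin n) R) (shiftR R n) 0 1 *
      fromBlocks 0 (shiftR R n) (shiftR R n)ᵀ (Matrix.single 0 0 1) =
      fromBlocks 1 (shiftR R n) (shiftR R n)ᵀ (Matrix.single 0 0 1) := by
    rw [fromBlocks_multiply]
    simp [h1, h2]
  have h3 := congrArg Matrix.det hmul
  rw [det_mul, det_fromBlocks_zero₂₁, det_one, det_one, one_mul, one_mul,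
    det_fromBlocks_one₁₁] at h3
  rw [h3]
  have h4 : (Matrix.single 0 0 1 - (shiftR R n)ᵀ * shiftR R n : Matrix (Fin (n+1)) (Fin (n+1)) R)
      = diagonal (Fin.cons 1 fun _ => -1) := by
    ext i j
    refine Fin.cases ?_ (fun i => ?_) i <;> refine Fin.cases ?_ (fun j => ?_) j
    · simp [mul_apply, shiftR, (Fin.succ_ne_zero _).symm]
    · simp [mul_apply, shiftR, (Fin.succ_ne_zero _).symm, single]
    · simp [mul_apply, shiftR, (Fin.succ_ne_zero _).symm, single]
    · simp [mul_apply, shiftR, single, diagonal_apply, eq_comm]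
      split_ifs <;> simp
  rw [h4, det_diagonal, Fin.prod_univ_succ]
  simp

/-- Auxiliary form of `det_bordered`, before cancelling a power of a minor. -/
lemma pow_mul_det_bordered (M : Matrix (Fin n) (Fin (n+1)) R)
    (S : Matrix (Fin (n+1)) (Fin (n+1)) R) (i : Fin (n+1)) :
    (minorVec M i) ^ n * (fromBlocks 0 M Mᵀ S).det =
      (minorVec M i) ^ n * ((-1) ^ n * ((S *ᵥ minorVec M) ⬝ᵥ minorVec M)) := by
  set Q := rowCons (Pi.single i 1) M with hQ
  have hdet : Q.det = minorVec M i := by rw [hQ, det_rowCons, single_one_dotProduct]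
  have hadj : ∀ j, Q.adjugate j 0 = minorVec M j := by
    intro j
    rw [hQ, adjugate_rowCons_zero]
  have hMQ : M * Q.adjugate = minorVec M i • shiftR R n := by
    have h := mul_adjugate Q
    rw [hdet] at h
    ext r j
    have h2 := congrFun (congrFun h r.succ) j
    simp only [mul_apply, hQ, rowCons_succ] at h2 ⊢
    rw [h2]
    simp [shiftR, one_apply, eq_comm]
  have h1 : shiftR R n * (shiftR R n)ᵀ = 1 := shiftR_mul_transpose
  have h2 : shiftR R n * (Matrix.single 0 0 1 : Matrix (Fin (n+1)) (Fin (n+1)) R) = 0 :=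
    shiftR_mul_single
  have hlast : Mᵀ * shiftR R n + S * Q.adjugate * Matrix.single 0 0 1 =
      (rowCons (S *ᵥ minorVec M) M)ᵀ := by
    ext a b
    have hS : (S * Q.adjugate) a 0 = (S *ᵥ minorVec M) a := by
      simp [mul_apply, mulVec, dotProduct, hadj]
    refine Fin.cases ?_ (fun b => ?_) b
    · simp [mul_apply (M := Mᵀ), shiftR, (Fin.succ_ne_zero _).symm, hS]
    · simp [mul_apply (M := Mᵀ), shiftR, Fin.succ_ne_zero]
  have hmul : fromBlocks 0 M Mᵀ S * (fromBlocks 1 0 0 Q.adjugate *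
      fromBlocks 0 (shiftR R n) (shiftR R n)ᵀ (Matrix.single 0 0 1)) =
      fromBlocks (minorVec M i • 1) 0 (S * Q.adjugate * (shiftR R n)ᵀ)
        (rowCons (S *ᵥ minorVec M) M)ᵀ := by
    rw [← Matrix.mul_assoc, fromBlocks_multiply, fromBlocks_multiply, ← hlast]
    simp [hMQ, h1, h2]
  have h3 := congrArg Matrix.det hmul
  rw [det_mul, det_mul, det_fromBlocks_zero₁₂, det_fromBlocks_zero₁₂, det_fromBlocks_shiftR,
    det_transpose, det_rowCons, det_one, one_mul, det_adjugate, hdet, det_smul, det_one,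
    Fintype.card_fin, Fintype.card_fin, Nat.add_sub_cancel] at h3
  have h4 : ((-1 : R) ^ n) * (-1) ^ n = 1 := by rw [← mul_pow]; simp
  linear_combination (-1) ^ n * h3 - minorVec M i ^ n * (fromBlocks 0 M Mᵀ S).det * h4

lemma det_bordered (M : Matrix (Fin n) (Fin (n+1)) R) (S : Matrix (Fin (n+1)) (Fin (n+1)) R) :
    (fromBlocks 0 M Mᵀ S).det = (-1) ^ n * ((S *ᵥ minorVec M) ⬝ᵥ minorVec M) := by
  let φ : Polynomial R →+* R := Polynomial.evalRingHom 0
  let M' : Matrix (Fin n) (Fin (n+1)) (Polynomial R) :=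
    (Polynomial.X : Polynomial R) • shiftR (Polynomial R) n + M.map Polynomial.C
  let S' : Matrix (Fin (n+1)) (Fin (n+1)) (Polynomial R) := S.map Polynomial.C
  have hM : M'.map φ = M := by
    ext a b
    simp [M', φ]
  have hS : S'.map φ = S := by
    ext a b
    simp [S', φ]
  have hmonic : (minorVec M' 0).Monic := by
    have : M'.submatrix id (Fin.succAbove 0) = (Polynomial.X : Polynomial R) • 1 +
        (M.submatrix id (Fin.succAbove 0)).map Polynomial.C := by
      ext a b
      simp [M', shiftR, one_apply, eq_comm]
    rw [minorVec, this, Polynomial.Monic]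
    simpa using Polynomial.leadingCoeff_det_X_one_add_C (M.submatrix id (Fin.succAbove 0))
  have h := (hmonic.pow n).isRegular.left (pow_mul_det_bordered M' S' 0)
  have h2 := congrArg φ h
  have h3 : (fromBlocks 0 M' M'ᵀ S').map φ = fromBlocks 0 M Mᵀ S := by
    rw [fromBlocks_map, hM, hS, transpose_map, hM]
    simp
  have h4 : (fun i => φ (minorVec M' i)) = minorVec M := by
    rw [← minorVec_map, hM]
  rw [RingHom.map_det, RingHom.mapMatrix_apply, h3, map_mul, map_pow, map_neg, map_one,
    RingHom.map_dotProduct] at h2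
  rw [h2]
  congr 1
  change (fun i => φ ((S' *ᵥ minorVec M') i)) ⬝ᵥ (fun i => φ (minorVec M' i)) = _
  simp_rw [RingHom.map_mulVec]
  change (S'.map φ *ᵥ (fun i => φ (minorVec M' i))) ⬝ᵥ _ = _
  rw [h4, hS]

end MinorVec
end LocalGlobal

namespace LocalGlobal

section Pencil

variable {R : Type*} [CommRing R] {n : ℕ}

/-- The pencil `X A - B` over `R[X]`. -/
noncomputable def pencil {m k : Type*} (A B : Matrix m k R) : Matrix m k (Polynomial R) :=
  (Polynomial.X : Polynomial R) • A.map Polynomial.C - B.map Polynomial.C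

lemma pencil_apply {m k : Type*} (A B : Matrix m k R) (i : m) (j : k) :
    pencil A B i j = Polynomial.X * Polynomial.C (A i j) - Polynomial.C (B i j) := by
  simp [pencil]

lemma pencil_map {S : Type*} [CommRing S] (φ : R →+* S) {m k : Type*} (A B : Matrix m k R) :
    (pencil A B).map (Polynomial.mapRingHom φ) = pencil (A.map φ) (B.map φ) := by
  ext1 i j
  simp [pencil_apply]

lemma minorVec_pencil (A B : Matrix (Fin n) (Fin (n+1)) R) (i : Fin (n+1)) :
    minorVec (pencil A B) i = Polynomial.C ((-1) ^ (i : ℕ)) *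
      ((Polynomial.X : Polynomial R) • (A.submatrix id i.succAbove).map Polynomial.C +
        (-(B.submatrix id i.succAbove)).map Polynomial.C).det := by
  rw [minorVec]
  congr 2
  · simp
  · ext1 a b
    simp [pencil_apply, sub_eq_add_neg]

lemma natDegree_minorVec_pencil_le (A B : Matrix (Fin n) (Fin (n+1)) R) (i : Fin (n+1)) :
    (minorVec (pencil A B) i).natDegree ≤ n := by
  rw [minorVec_pencil]
  refine (Polynomial.natDegree_C_mul_le _ _).trans ?_
  simpa using Polynomial.natDegree_det_X_add_C_le (A.submatrix id i.succAbove)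
    (-(B.submatrix id i.succAbove))

lemma coeff_minorVec_pencil (A B : Matrix (Fin n) (Fin (n+1)) R) (i : Fin (n+1)) :
    (minorVec (pencil A B) i).coeff n = minorVec A i := by
  rw [minorVec_pencil, Polynomial.coeff_C_mul]
  have := Polynomial.coeff_det_X_add_C_card (A.submatrix id i.succAbove)
    (-(B.submatrix id i.succAbove))
  rw [Fintype.card_fin] at this
  rw [this, minorVec]

/-- The matrix of coefficients of the signed maximal minors of the pencil `X A - B`. -/
noncomputable def coeffMat (A B : Matrix (Fin n) (Fin (n+1)) R) :
    Matrix (Fin (n+1)) (Fin (n+1)) R :=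
  Matrix.of fun i j => (minorVec (pencil A B) i).coeff j

/-- The vector of powers `1, X, …, X ^ n`. -/
noncomputable def powVec (R : Type*) [CommRing R] (n : ℕ) : Fin (n+1) → Polynomial R :=
  fun j => Polynomial.X ^ (j : ℕ)

lemma map_C_mulVec_powVec {m : Type*} (T : Matrix m (Fin (n+1)) R) (i : m) :
    (T.map Polynomial.C *ᵥ powVec R n) i =
      ∑ j : Fin (n+1), Polynomial.C (T i j) * Polynomial.X ^ (j : ℕ) := rfl

lemma minorVec_pencil_eq (A B : Matrix (Fin n) (Fin (n+1)) R) :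
    minorVec (pencil A B) = (coeffMat A B).map Polynomial.C *ᵥ powVec R n := by
  funext i
  rw [map_C_mulVec_powVec]
  conv_lhs => rw [Polynomial.as_sum_range_C_mul_X_pow' _
    (Nat.lt_succ_of_le (natDegree_minorVec_pencil_le A B i))]
  rw [Finset.sum_range]
  rfl

lemma coeffMat_map {S : Type*} [CommRing S] (φ : R →+* S) (A B : Matrix (Fin n) (Fin (n+1)) R) :
    coeffMat (A.map φ) (B.map φ) = (coeffMat A B).map φ := by
  ext i j
  simp only [coeffMat, of_apply, map_apply, ← pencil_map, minorVec_map]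
  simp

lemma map_C_mulVec_powVec_injective {m : Type*} {T U : Matrix m (Fin (n+1)) R}
    (h : T.map Polynomial.C *ᵥ powVec R n = U.map Polynomial.C *ᵥ powVec R n) : T = U := by
  ext i j
  have h2 := congrArg (fun P => Polynomial.coeff P j) (congrFun h i)
  simpa [map_C_mulVec_powVec, Polynomial.finsetSum_coeff, Polynomial.coeff_X_pow, Fin.val_inj]
    using h2

end Pencil

section Squarefree

variable {K : Type*} [Field K] {n : ℕ}

lemma eq_zero_of_vecMul_pencil_eq_C (A B : Matrix (Fin n) (Fin (n+1)) K) (i : Fin (n+1))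
    (hi : minorVec A i ≠ 0) (r : Fin n → Polynomial K) (c : Fin (n+1) → K)
    (h : r ᵥ* pencil A B = fun j => Polynomial.C (c j)) : r = 0 := by
  have descend : ∀ d, (∀ k, ∀ j ≥ d + 1, (r k).coeff j = 0) → ∀ k, ∀ j ≥ d, (r k).coeff j = 0 := by
    intro d hd
    have hz : (fun k => (r k).coeff d) ᵥ* A = 0 := by
      funext j
      have h2 := congrArg (fun P => Polynomial.coeff P (d + 1)) (congrFun h j)
      simp only [vecMul, dotProduct, pencil_apply, mul_sub, ← mul_assoc,
        Polynomial.finsetSum_coeff, Polynomial.coeff_sub, Polynomial.coeff_mul_C,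
        Polynomial.coeff_mul_X, Polynomial.coeff_C_succ] at h2
      rw [Pi.zero_apply, ← h2, vecMul, dotProduct]
      refine Finset.sum_congr rfl fun k _ => ?_
      rw [hd k (d + 1) le_rfl]
      ring
    have hz2 := eq_zero_of_vecMul_rows_eq_zero A i hi _ hz
    intro k j hj
    rcases hj.eq_or_lt with rfl | hlt
    · exact congrFun hz2 k
    · exact hd k j hlt
  have hall : ∀ D, (∀ k, ∀ j ≥ D, (r k).coeff j = 0) → ∀ k, ∀ j ≥ 0, (r k).coeff j = 0 := by
    intro D
    induction D with
    | zero => exact id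
    | succ d ih => exact fun hd => ih (descend d hd)
  have hbound : ∀ k, ∀ j ≥ (∑ k, ((r k).natDegree + 1)), (r k).coeff j = 0 := by
    intro k j hj
    apply Polynomial.coeff_eq_zero_of_natDegree_lt
    have := Finset.single_le_sum (f := fun k => (r k).natDegree + 1) (fun _ _ => Nat.zero_le _)
      (Finset.mem_univ k)
    omega
  funext k
  ext j
  exact hall _ hbound k j (Nat.zero_le j)

/-- If the form attached to a pair is squarefree of almost full degree, then the maximal minors
of the top right pencil are linearly independent. -/
theorem det_coeffMat_ne_zero (A B : Matrix (Fin n) (Fin (n+1)) K)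
    (S : Matrix (Fin (n+1)) (Fin (n+1)) (Polynomial K))
    (hS : ∀ i j, (S i j).natDegree ≤ 1)
    (hsf : Squarefree ((S *ᵥ minorVec (pencil A B)) ⬝ᵥ minorVec (pencil A B)))
    (hdeg : 2 * n ≤ ((S *ᵥ minorVec (pencil A B)) ⬝ᵥ minorVec (pencil A B)).natDegree) :
    (coeffMat A B).det ≠ 0 := by
  intro hdet
  obtain ⟨c, hc0, hc⟩ := exists_vecMul_eq_zero_iff.mpr hdet
  set v := minorVec (pencil A B) with hv
  set F := (S *ᵥ v) ⬝ᵥ v with hF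
  have hcv : (fun j => Polynomial.C (c j)) ⬝ᵥ v = 0 := by
    rw [hv, minorVec_pencil_eq, dotProduct_mulVec]
    have : (fun j => Polynomial.C (c j)) ᵥ* (coeffMat A B).map Polynomial.C = 0 := by
      funext j
      have := congrArg (Polynomial.C (R := K)) (congrFun hc j)
      simpa [vecMul, dotProduct] using this
    rw [this, zero_dotProduct]
  have hF0 : F ≠ 0 := hsf.ne_zero
  -- the minors are coprime
  have hspan : (1 : Polynomial K) ∈ Ideal.span (Set.range v) := by
    obtain ⟨g, hg⟩ := (IsPrincipalIdealRing.principal (Ideal.span (Set.range v))).principal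
    have hdvd : ∀ i, g ∣ v i := by
      intro i
      rw [← Ideal.mem_span_singleton]
      have : v i ∈ Ideal.span (Set.range v) := Ideal.subset_span ⟨i, rfl⟩
      rw [hg] at this
      exact this
    have hgg : g * g ∣ F := by
      rw [hF, dotProduct]
      refine Finset.dvd_sum fun i _ => mul_dvd_mul ?_ (hdvd i)
      rw [mulVec, dotProduct]
      exact Finset.dvd_sum fun j _ => (hdvd j).mul_left _
    have hu : IsUnit g := hsf g hgg
    have htop : Ideal.span (Set.range v) = ⊤ := by
      rw [hg]
      exact Ideal.span_singleton_eq_top.mpr hu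
    rw [htop]; trivial
  obtain ⟨a, ha⟩ := (Ideal.mem_span_range_iff_exists_fun).mp hspan
  choose q hq using exists_vecMul_eq_smul (pencil A B) (fun j => Polynomial.C (c j)) hcv
  -- the leading minors are not all zero
  have hlead : ∃ i, minorVec A i ≠ 0 := by
    by_contra! hall
    have hco : ∀ i, (v i).coeff n = 0 := fun i => by rw [hv, coeff_minorVec_pencil, hall]
    rcases Nat.eq_zero_or_pos n with rfl | hn
    · apply hF0
      have : v = 0 := by
        funext i
        have h1 := natDegree_minorVec_pencil_le A B i
        rw [← hv] at h1
        rw [Polynomial.eq_C_of_natDegree_le_zero h1, hco i]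
        simp
      rw [hF, this, dotProduct_zero]
    · have hlt : ∀ i, (v i).natDegree ≤ n - 1 := by
        intro i
        have h1 := natDegree_minorVec_pencil_le A B i
        rw [← hv] at h1
        rcases h1.eq_or_lt with h2 | h2
        · have h3 : (v i).leadingCoeff = 0 := by rw [Polynomial.leadingCoeff, h2, hco]
          rw [Polynomial.leadingCoeff_eq_zero] at h3
          simp [h3]
        · omega
      have : F.natDegree ≤ 1 + (n - 1) + (n - 1) := by
        rw [hF, dotProduct]
        refine Polynomial.natDegree_sum_le_of_forall_le _ _ fun i _ => ?_
        refine Polynomial.natDegree_mul_le.trans (add_le_add ?_ (hlt i))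
        rw [mulVec, dotProduct]
        refine Polynomial.natDegree_sum_le_of_forall_le _ _ fun j _ => ?_
        exact Polynomial.natDegree_mul_le.trans (add_le_add (hS i j) (hlt j))
      omega
  obtain ⟨i₀, hi₀⟩ := hlead
  set r : Fin n → Polynomial K := ∑ i, a i • q i with hr
  have hrM : r ᵥ* pencil A B = fun j => Polynomial.C (c j) := by
    rw [hr, sum_vecMul]
    simp_rw [smul_vecMul, hq, smul_smul]
    rw [← Finset.sum_smul]
    rw [ha, one_smul]
  have hr0 := eq_zero_of_vecMul_pencil_eq_C A B i₀ hi₀ r c hrM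
  apply hc0
  funext j
  have := congrFun hrM j
  rw [hr0, zero_vecMul] at this
  exact (Polynomial.C_eq_zero.mp this.symm)

end Squarefree
end LocalGlobal

namespace LocalGlobal

section StandardPencil

variable (R : Type*) [CommRing R] (n : ℕ)

/-- The `n × (n+1)` matrix `[-I | 0]`. -/
def stdA : Matrix (Fin n) (Fin (n+1)) R := Matrix.of fun i j => if j = i.castSucc then -1 else 0

/-- The `n × (n+1)` matrix `[0 | -I]`. -/
def stdB : Matrix (Fin n) (Fin (n+1)) R := Matrix.of fun i j => if j = i.succ then -1 else 0

variable {R n}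

lemma pencil_mul {m k l : Type*} [Fintype k] (A B : Matrix m k R) (V : Matrix k l R) :
    pencil A B * V.map Polynomial.C = pencil (A * V) (B * V) := by
  rw [pencil, pencil, Matrix.sub_mul, Matrix.smul_mul, Matrix.map_mul, Matrix.map_mul]

lemma mul_pencil {m k l : Type*} [Fintype m] (H : Matrix l m R) (A B : Matrix m k R) :
    H.map Polynomial.C * pencil A B = pencil (H * A) (H * B) := by
  rw [pencil, pencil, Matrix.mul_sub, Matrix.mul_smul, Matrix.map_mul, Matrix.map_mul]

@[simp] lemma mul_stdA_castSucc {m : Type*} (N : Matrix m (Fin n) R) (i : m) (j : Fin n) :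
    (N * stdA R n) i j.castSucc = -N i j := by
  simp [mul_apply, stdA]

@[simp] lemma mul_stdA_last {m : Type*} (N : Matrix m (Fin n) R) (i : m) :
    (N * stdA R n) i (Fin.last n) = 0 := by
  simp [mul_apply, stdA, (Fin.castSucc_ne_last _).symm]

@[simp] lemma mul_stdB_succ {m : Type*} (N : Matrix m (Fin n) R) (i : m) (j : Fin n) :
    (N * stdB R n) i j.succ = -N i j := by
  simp [mul_apply, stdB]

@[simp] lemma mul_stdB_zero {m : Type*} (N : Matrix m (Fin n) R) (i : m) :
    (N * stdB R n) i 0 = 0 := by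
  simp [mul_apply, stdB, (Fin.succ_ne_zero _).symm]

lemma minorVec_std : minorVec (pencil (stdA R n) (stdB R n)) = powVec R n := by
  have h0 : minorVec (pencil (stdA R n) (stdB R n)) 0 = 1 := by
    rw [minorVec, det_of_isLowerTriangular]
    · simp [pencil_apply, stdA, stdB, Fin.ext_iff]
    · intro i j hij
      have hij' : i < j := hij
      have h1 : j.succ ≠ i.castSucc := by
        simp only [ne_eq, Fin.ext_iff, Fin.val_succ, Fin.val_castSucc]; omega
      simp [pencil_apply, stdA, stdB, h1, hij'.ne']
  have hs : ∀ r : Fin n, minorVec (pencil (stdA R n) (stdB R n)) r.succ =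
      Polynomial.X * minorVec (pencil (stdA R n) (stdB R n)) r.castSucc := by
    intro r
    have h := congrFun (mulVec_minorVec (pencil (stdA R n) (stdB R n))) r
    have h2 : ∀ j, pencil (stdA R n) (stdB R n) r j =
        (if j = r.castSucc then -Polynomial.X else 0) + (if j = r.succ then 1 else 0) := by
      intro j
      rw [pencil_apply, stdA, stdB]
      simp only [of_apply]
      split_ifs <;> simp
    simp only [mulVec, dotProduct, h2, add_mul, Finset.sum_add_distrib, ite_mul, zero_mul, one_mul,
      Finset.sum_ite_eq', Finset.mem_univ, if_true, Pi.zero_apply] at h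
    linear_combination h
  funext i
  induction i using Fin.induction with
  | zero => simp [h0, powVec]
  | succ i ih =>
    rw [hs, ih]
    simp [powVec, pow_succ']

/-- A pencil is carried to a multiple of the standard one by its coefficient matrix. -/
lemma exists_mul_coeffMat (A B : Matrix (Fin n) (Fin (n+1)) R) :
    ∃ H : Matrix (Fin n) (Fin n) R,
      A * coeffMat A B = H * stdA R n ∧ B * coeffMat A B = H * stdB R n := by
  set V := coeffMat A B with hV
  have h := mulVec_minorVec (pencil A B)
  rw [minorVec_pencil_eq, ← hV] at h
  have hcoeff : ∀ r k, (∑ j : Fin (n+1), if k = (j : ℕ) + 1 then (A * V) r j else 0) =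
      ∑ j : Fin (n+1), if k = (j : ℕ) then (B * V) r j else 0 := by
    intro r k
    rw [mulVec_mulVec, pencil_mul] at h
    have h2 := congrArg (fun P => Polynomial.coeff P k) (congrFun h r)
    have h3 : ∀ j, (Polynomial.X * Polynomial.C ((A * V) r j) - Polynomial.C ((B * V) r j)) *
        Polynomial.X ^ (j : ℕ) = Polynomial.C ((A * V) r j) * Polynomial.X ^ ((j : ℕ) + 1) -
          Polynomial.C ((B * V) r j) * Polynomial.X ^ (j : ℕ) := fun j => by ring
    simp only [mulVec, dotProduct, pencil_apply, powVec, h3, Polynomial.finsetSum_coeff,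
      Polynomial.coeff_sub, Polynomial.coeff_C_mul_X_pow, Finset.sum_sub_distrib, Pi.zero_apply,
      Polynomial.coeff_zero] at h2
    exact sub_eq_zero.mp h2
  have hlast : ∀ r, (A * V) r (Fin.last n) = 0 := by
    intro r
    have := hcoeff r (n + 1)
    rw [Finset.sum_eq_single (Fin.last n), Finset.sum_eq_zero] at this
    · simpa using this
    · intro j _
      rw [if_neg]; omega
    · intro j _ hj
      rw [if_neg]
      intro h'
      exact hj (Fin.ext (by simp; omega))
    · simp
  have hzero : ∀ r, (B * V) r 0 = 0 := by
    intro r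
    have := hcoeff r 0
    rw [Finset.sum_eq_zero (fun j _ => by rw [if_neg]; omega), Finset.sum_eq_single 0] at this
    · simpa using this.symm
    · intro j _ hj
      rw [if_neg]
      intro h'
      exact hj (Fin.ext (by rw [Fin.val_zero]; omega))
    · simp
  have hmid : ∀ r (j : Fin n), (A * V) r j.castSucc = (B * V) r j.succ := by
    intro r j
    have := hcoeff r (j + 1)
    rw [Finset.sum_eq_single j.castSucc, Finset.sum_eq_single j.succ] at this
    · simpa using this
    · intro j' _ hj
      rw [if_neg]
      intro h'
      exact hj (Fin.ext (by simp; omega))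
    · simp
    · intro j' _ hj
      rw [if_neg]
      intro h'
      exact hj (Fin.ext (by simp; omega))
    · simp
  refine ⟨Matrix.of fun r j => -(A * V) r j.castSucc, ?_, ?_⟩
  · ext r j
    refine Fin.lastCases ?_ (fun j => ?_) j
    · rw [hlast, mul_stdA_last]
    · simp
  · ext r j
    refine Fin.cases ?_ (fun j => ?_) j
    · rw [hzero, mul_stdB_zero]
    · rw [mul_stdB_succ, ← hmid]; simp

lemma det_eq_det_coeffMat (A B : Matrix (Fin n) (Fin (n+1)) R)
    (hV : IsUnit (coeffMat A B).det) (H : Matrix (Fin n) (Fin n) R)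
    (hA : A * coeffMat A B = H * stdA R n) (hB : B * coeffMat A B = H * stdB R n) :
    H.det = (coeffMat A B).det := by
  set V := coeffMat A B with hVdef
  have h1 : pencil A B * V.map Polynomial.C =
      H.map Polynomial.C * pencil (stdA R n) (stdB R n) := by
    rw [pencil_mul, hA, hB, mul_pencil]
  have h2 := mulVec_minorVec_mul 1 (pencil A B) (V.map Polynomial.C)
  have h3 := mulVec_minorVec_mul (H.map Polynomial.C) (pencil (stdA R n) (stdB R n)) 1
  rw [Matrix.mul_one, ← h1, one_mulVec, det_one, mul_one, minorVec_std] at h3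
  rw [Matrix.one_mul, h3, det_one, one_mul, minorVec_pencil_eq, ← hVdef, mulVec_smul] at h2
  have hdet : ∀ {k : ℕ} (N : Matrix (Fin k) (Fin k) R),
      (N.map Polynomial.C).det = Polynomial.C N.det := fun N => by
    rw [RingHom.map_det, RingHom.mapMatrix_apply]
  rw [hdet, hdet] at h2
  have h4 : (H.det • V).map Polynomial.C *ᵥ powVec R n =
      (V.det • V).map Polynomial.C *ᵥ powVec R n := by
    have : ∀ c : R, (c • V).map Polynomial.C = Polynomial.C c • V.map Polynomial.C := by
      intro c; ext1 i j; simp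
    rw [this, this, smul_mulVec, smul_mulVec, h2]
  have h5 := map_C_mulVec_powVec_injective h4
  have h6 := congrArg (fun N => (N * V⁻¹) 0 0) h5
  simpa [Matrix.smul_mul, mul_nonsing_inv _ hV] using h6

end StandardPencil

section SymmetricPart

variable {R : Type*} [CommRing R] {n : ℕ}

/-- Partial antidiagonal sums. -/
def diagSum (c : ℕ → ℕ → R) (p t : ℕ) : R := ∑ k ∈ Finset.range p, c k (t - k)

lemma diagSum_succ (c : ℕ → ℕ → R) (p t : ℕ) :
    diagSum c (p + 1) t = diagSum c p t + c p (t - p) := Finset.sum_range_succ _ _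

lemma diagSum_add_diagSum (c : ℕ → ℕ → R) (hc : ∀ i j, c i j = c j i) {p q t : ℕ}
    (h : p + q = t + 1) : diagSum c p t + diagSum c q t = diagSum c (t + 1) t := by
  rw [diagSum, diagSum, diagSum, ← h, Finset.sum_range_add]
  congr 1
  rw [← Finset.sum_range_reflect]
  refine Finset.sum_congr rfl fun k hk => ?_
  rw [Finset.mem_range] at hk
  rw [hc]
  congr 1 <;> omega

/-- The solution of the linear system solved in `exists_add_transpose_eq`. -/
def antidiagSol (a b : ℕ → ℕ → R) (i j : ℕ) : R :=
  diagSum b (i + 1) (i + j + 1) - diagSum a i (i + j)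

lemma antidiagSol_add_swap {a b : ℕ → ℕ → R} (ha : ∀ i j, a i j = a j i)
    (hb : ∀ i j, b i j = b j i)
    (hab : ∀ s, diagSum b (s + 2) (s + 1) = diagSum a (s + 1) s) (i j : ℕ) :
    antidiagSol a b i j + antidiagSol a b j i = a i j := by
  have h1 := diagSum_add_diagSum b hb (p := i + 1) (q := j + 1) (t := i + j + 1) (by omega)
  have h2 := diagSum_add_diagSum a ha (p := i) (q := j + 1) (t := i + j) (by omega)
  have h3 := hab (i + j)
  rw [diagSum_succ a j, show i + j - j = i by omega] at h2
  rw [antidiagSol, antidiagSol, add_comm j i, ha i j]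
  linear_combination h1 + h3 - h2

lemma antidiagSol_succ_add_swap {a b : ℕ → ℕ → R} (ha : ∀ i j, a i j = a j i)
    (hb : ∀ i j, b i j = b j i)
    (hab : ∀ s, diagSum b (s + 2) (s + 1) = diagSum a (s + 1) s) (i j : ℕ) :
    antidiagSol a b (i + 1) j + antidiagSol a b (j + 1) i = b (i + 1) (j + 1) := by
  have h1 := diagSum_add_diagSum b hb (p := i + 2) (q := j + 1) (t := i + j + 2) (by omega)
  have h2 := diagSum_add_diagSum a ha (p := i + 1) (q := j + 1) (t := i + j + 1) (by omega)
  have h3 := hab (i + j + 1)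
  have h4 := diagSum_succ b (j + 1) (i + j + 2)
  rw [show i + j + 2 - (j + 1) = i + 1 by omega] at h4
  rw [antidiagSol, antidiagSol, show i + 1 + j + 1 = i + j + 2 by omega,
    show j + 1 + i + 1 = i + j + 2 by omega, show i + 1 + j = i + j + 1 by omega,
    show j + 1 + i = i + j + 1 by omega, hb (i + 1)]
  linear_combination h1 + h4 + h3 - h2

/-- Extension of a matrix by zero. -/
def extMat (T : Matrix (Fin (n+1)) (Fin (n+1)) R) (i j : ℕ) : R :=
  if h : i < n + 1 ∧ j < n + 1 then T ⟨i, h.1⟩ ⟨j, h.2⟩ else 0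

lemma extMat_val (T : Matrix (Fin (n+1)) (Fin (n+1)) R) (i j : Fin (n+1)) :
    extMat T i j = T i j := by
  simp [extMat, i.2, j.2]

lemma extMat_symm {T : Matrix (Fin (n+1)) (Fin (n+1)) R} (hT : T.IsSymm) (i j : ℕ) :
    extMat T i j = extMat T j i := by
  unfold extMat
  by_cases h : i < n + 1 ∧ j < n + 1
  · rw [dif_pos h, dif_pos h.symm, hT.apply]
  · rw [dif_neg h, dif_neg (fun h' => h h'.symm)]

lemma extMat_eq_zero {T : Matrix (Fin (n+1)) (Fin (n+1)) R} {i j : ℕ} (h : n < j) :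
    extMat T i j = 0 := by
  rw [extMat, dif_neg]; omega

lemma extMat_eq_zero' {T : Matrix (Fin (n+1)) (Fin (n+1)) R} {i j : ℕ} (h : n < i) :
    extMat T i j = 0 := by
  rw [extMat, dif_neg]; omega

lemma sum_ite_add_eq (T : Matrix (Fin (n+1)) (Fin (n+1)) R) (s : ℕ) :
    (∑ i : Fin (n+1), ∑ j : Fin (n+1), if s = (i : ℕ) + j then T i j else 0) =
      diagSum (extMat T) (s + 1) s := by
  have h1 : ∀ i : Fin (n+1), (∑ j : Fin (n+1), if s = (i : ℕ) + j then T i j else 0) =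
      if (i : ℕ) < s + 1 then extMat T i (s - i) else 0 := by
    intro i
    by_cases hi : (i : ℕ) < s + 1
    · rw [if_pos hi]
      by_cases hs : s - i < n + 1
      · rw [Finset.sum_eq_single ⟨s - i, hs⟩]
        · rw [if_pos (by simp; omega)]
          exact (extMat_val T i ⟨s - i, hs⟩).symm
        · intro j _ hj
          rw [if_neg]
          intro h
          exact hj (Fin.ext (by simp; omega))
        · simp
      · rw [extMat_eq_zero (by omega)]
        refine Finset.sum_eq_zero fun j _ => ?_
        rw [if_neg]; omega
    · rw [if_neg hi]
      refine Finset.sum_eq_zero fun j _ => ?_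
      rw [if_neg]; omega
  simp_rw [h1]
  rw [← Finset.sum_range (fun i => if i < s + 1 then extMat T i (s - i) else 0),
    ← Finset.sum_filter, diagSum]
  apply Finset.sum_subset
  · intro i; simp
  · intro i hi hi'
    apply extMat_eq_zero'
    simp at hi hi'
    omega

/-- A symmetric pencil vanishing on the powers is in the image of the unipotent action. -/
lemma exists_add_transpose_eq (TA TB : Matrix (Fin (n+1)) (Fin (n+1)) R) (hA : TA.IsSymm)
    (hB : TB.IsSymm) (h : (pencil TA TB *ᵥ powVec R n) ⬝ᵥ powVec R n = 0) :
    ∃ u : Matrix (Fin (n+1)) (Fin n) R, u * stdA R n + (u * stdA R n)ᵀ = TA ∧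
      u * stdB R n + (u * stdB R n)ᵀ = TB := by
  have hcoeff : ∀ k, (∑ i : Fin (n+1), ∑ j : Fin (n+1), if k = (i : ℕ) + j + 1 then TA i j else 0) =
      ∑ i : Fin (n+1), ∑ j : Fin (n+1), if k = (i : ℕ) + j then TB i j else 0 := by
    intro k
    have h2 := congrArg (fun P => Polynomial.coeff P k) h
    have h3 : ∀ i j, (Polynomial.X * Polynomial.C (TA i j) - Polynomial.C (TB i j)) *
        Polynomial.X ^ (j : ℕ) * Polynomial.X ^ (i : ℕ) =
          Polynomial.C (TA i j) * Polynomial.X ^ ((i : ℕ) + j + 1) -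
          Polynomial.C (TB i j) * Polynomial.X ^ ((i : ℕ) + j) := fun i j => by ring
    simp only [mulVec, dotProduct, pencil_apply, powVec, Finset.sum_mul, h3,
      Polynomial.finsetSum_coeff, Polynomial.coeff_sub, Polynomial.coeff_C_mul_X_pow,
      Finset.sum_sub_distrib, Polynomial.coeff_zero] at h2
    exact sub_eq_zero.mp h2
  set a := extMat TA
  set b := extMat TB
  have hab : ∀ s, diagSum b (s + 2) (s + 1) = diagSum a (s + 1) s := by
    intro s
    rw [← sum_ite_add_eq, ← sum_ite_add_eq, ← hcoeff]
    simp
  have hb0 : b 0 0 = 0 := by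
    have h1 := hcoeff 0
    rw [sum_ite_add_eq] at h1
    simpa [diagSum] using h1.symm
  have hUlast : ∀ i, antidiagSol a b i n = 0 := by
    intro i
    rw [antidiagSol, diagSum, diagSum, Finset.sum_eq_zero, Finset.sum_eq_zero, sub_zero]
    · intro k hk
      rw [Finset.mem_range] at hk
      exact extMat_eq_zero (by omega)
    · intro k hk
      rw [Finset.mem_range] at hk
      exact extMat_eq_zero (by omega)
  have hUzero : ∀ j, antidiagSol a b 0 j = b 0 (j + 1) := by
    intro j
    simp [antidiagSol, diagSum]
  let u : Matrix (Fin (n+1)) (Fin n) R := Matrix.of fun i j => -antidiagSol a b i j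
  have huA : ∀ i j : Fin (n+1), (u * stdA R n) i j = antidiagSol a b i j := by
    intro i j
    refine Fin.lastCases ?_ (fun j => ?_) j
    · rw [mul_stdA_last, Fin.val_last, hUlast]
    · rw [mul_stdA_castSucc]; simp [u]
  have huB : ∀ (i : Fin (n+1)) (j : Fin n), (u * stdB R n) i j.succ = antidiagSol a b i j := by
    intro i j
    rw [mul_stdB_succ]; simp [u]
  refine ⟨u, ?_, ?_⟩
  · ext i j
    rw [Matrix.add_apply, transpose_apply, huA, huA,
      antidiagSol_add_swap (extMat_symm hA) (extMat_symm hB) hab, extMat_val]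
  · ext i j
    rw [Matrix.add_apply, transpose_apply, ← extMat_val TB]
    refine Fin.cases ?_ (fun i => ?_) i <;> refine Fin.cases ?_ (fun j => ?_) j
    · rw [mul_stdB_zero, add_zero]; exact hb0.symm
    · rw [mul_stdB_zero, huB, add_zero]; exact hUzero j
    · rw [mul_stdB_zero, huB, zero_add, extMat_symm hB]; exact hUzero i
    · rw [huB, huB]
      exact antidiagSol_succ_add_swap (extMat_symm hA) (extMat_symm hB) hab i j

lemma eq_zero_of_add_transpose_eq_zero (u : Matrix (Fin (n+1)) (Fin n) R)
    (hA : u * stdA R n + (u * stdA R n)ᵀ = 0) (hB : u * stdB R n + (u * stdB R n)ᵀ = 0) :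
    u = 0 := by
  have hA' : ∀ i j, (u * stdA R n) i j + (u * stdA R n) j i = 0 :=
    fun i j => congrFun (congrFun hA i) j
  have hB' : ∀ i j, (u * stdB R n) i j + (u * stdB R n) j i = 0 :=
    fun i j => congrFun (congrFun hB i) j
  have key : ∀ i : Fin (n+1), ∀ j, u i j = 0 := by
    intro i
    induction i using Fin.induction with
    | zero =>
      intro j
      have := hB' 0 j.succ
      simpa using this
    | succ i ih =>
      intro j
      have h1 := hB' i.succ j.succ
      have h2 := hA' j.succ i.castSucc
      have h3 : (u * stdA R n) i.castSucc j.succ = 0 := by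
        generalize j.succ = k
        refine Fin.lastCases ?_ (fun k => ?_) k
        · simp
        · simp [ih]
      rw [h3, mul_stdA_castSucc] at h2
      rw [mul_stdB_succ, mul_stdB_succ] at h1
      linear_combination h2 - h1
  ext i j
  exact key i j

end SymmetricPart
end LocalGlobal

namespace LocalGlobal

section Parabolic

variable {m k R : Type*} [Fintype m] [Fintype k] [DecidableEq m] [DecidableEq k] [CommRing R]

variable (m k R) in
/-- The block lower triangular matrices of determinant one. -/
def parab : Submonoid (Matrix (m ⊕ k) (m ⊕ k) R) where
  carrier := {g | g.toBlocks₁₂ = 0 ∧ g.det = 1}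
  one_mem' := by
    refine ⟨?_, det_one⟩
    ext i j
    simp [toBlocks₁₂]
  mul_mem' := by
    rintro a b ⟨ha, ha'⟩ ⟨hb, hb'⟩
    refine ⟨?_, by rw [det_mul, ha', hb', one_mul]⟩
    rw [← fromBlocks_toBlocks a, ← fromBlocks_toBlocks b, fromBlocks_multiply,
      toBlocks_fromBlocks₁₂, ha, hb, Matrix.mul_zero, Matrix.zero_mul, add_zero]

lemma mem_parab {g : Matrix (m ⊕ k) (m ⊕ k) R} :
    g ∈ parab m k R ↔ g.toBlocks₁₂ = 0 ∧ g.det = 1 := Iff.rfl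

lemma fromBlocks_mem_parab {a : Matrix m m R} {u : Matrix k m R} {d : Matrix k k R} :
    fromBlocks a 0 u d ∈ parab m k R ↔ a.det * d.det = 1 := by
  rw [mem_parab, toBlocks_fromBlocks₁₂, det_fromBlocks_zero₁₂]
  simp

lemma exists_eq_fromBlocks {g : Matrix (m ⊕ k) (m ⊕ k) R} (hg : g ∈ parab m k R) :
    ∃ (a : Matrix m m R) (u : Matrix k m R) (d : Matrix k k R),
      g = fromBlocks a 0 u d ∧ a.det * d.det = 1 := by
  have h : g = fromBlocks g.toBlocks₁₁ 0 g.toBlocks₂₁ g.toBlocks₂₂ := by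
    conv_lhs => rw [← fromBlocks_toBlocks g, hg.1]
  refine ⟨_, _, _, h, ?_⟩
  rw [← fromBlocks_mem_parab (u := g.toBlocks₂₁), ← h]
  exact hg

lemma parab_mul_adjugate {g : Matrix (m ⊕ k) (m ⊕ k) R} (hg : g ∈ parab m k R) :
    g * g.adjugate = 1 := by
  rw [mul_adjugate, hg.2, one_smul]

lemma parab_adjugate_mul {g : Matrix (m ⊕ k) (m ⊕ k) R} (hg : g ∈ parab m k R) :
    g.adjugate * g = 1 := by
  rw [adjugate_mul, hg.2, one_smul]

lemma adjugate_mem_parab {g : Matrix (m ⊕ k) (m ⊕ k) R} (hg : g ∈ parab m k R) :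
    g.adjugate ∈ parab m k R := by
  have h1 := parab_mul_adjugate hg
  have h2 := congrArg Matrix.det h1
  rw [det_mul, hg.2, one_mul, det_one] at h2
  refine ⟨?_, h2⟩
  obtain ⟨a, u, d, rfl, had⟩ := exists_eq_fromBlocks hg
  rw [← fromBlocks_toBlocks (fromBlocks a 0 u d).adjugate, fromBlocks_multiply,
    ← fromBlocks_one, fromBlocks_inj] at h1
  have h3 := h1.2.1
  rw [Matrix.zero_mul, add_zero] at h3
  have h4 := congrArg (fun N => a⁻¹ * N) h3
  simpa [← Matrix.mul_assoc, nonsing_inv_mul a (IsUnit.of_mul_eq_one _ had)] using h4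

lemma map_mem_parab {S : Type*} [CommRing S] (φ : R →+* S) {g : Matrix (m ⊕ k) (m ⊕ k) R}
    (hg : g ∈ parab m k R) : g.map φ ∈ parab m k S := by
  refine ⟨?_, ?_⟩
  · ext i j
    have h := congrFun (congrFun hg.1 i) j
    simp only [toBlocks₁₂, of_apply, map_apply, Matrix.zero_apply] at h ⊢
    rw [h, map_zero]
  · have h := RingHom.map_det φ g
    rw [hg.2, map_one] at h
    exact h.symm

lemma mem_parab_of_map {S : Type*} [CommRing S] {φ : R →+* S} (hφ : Function.Injective φ)
    {g : Matrix (m ⊕ k) (m ⊕ k) R} (hg : g.map φ ∈ parab m k S) : g ∈ parab m k R := by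
  refine ⟨?_, hφ ?_⟩
  · ext i j
    have h := congrFun (congrFun hg.1 i) j
    simp only [toBlocks₁₂, of_apply, map_apply, Matrix.zero_apply] at h ⊢
    exact hφ (by rw [h, map_zero])
  · rw [map_one, RingHom.map_det]
    exact hg.2

end Parabolic

section Action

variable {m R S : Type*} [CommRing R] [CommRing S]

/-- Simultaneous congruence of a pair of matrices. -/
def act [Fintype m] (g : Matrix m m R) (w : Matrix m m R × Matrix m m R) : Matrix m m R × Matrix m m R :=
  (g * w.1 * gᵀ, g * w.2 * gᵀ)

lemma act_mul [Fintype m] (g h : Matrix m m R) (w : Matrix m m R × Matrix m m R) :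
    act (g * h) w = act g (act h w) := by
  simp [act, Matrix.mul_assoc, transpose_mul]

lemma act_one [Fintype m] [DecidableEq m] (w : Matrix m m R × Matrix m m R) : act 1 w = w := by
  simp [act]

/-- Entrywise application of a ring homomorphism to a pair. -/
def mapW (φ : R →+* S) (w : Matrix m m R × Matrix m m R) : Matrix m m S × Matrix m m S :=
  (w.1.map φ, w.2.map φ)

lemma mapW_act [Fintype m] (φ : R →+* S) (g : Matrix m m R) (w : Matrix m m R × Matrix m m R) :
    mapW φ (act g w) = act (g.map φ) (mapW φ w) := by
  simp [act, mapW, Matrix.map_mul, transpose_map]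

lemma mapW_injective {φ : R →+* S} (hφ : Function.Injective φ) :
    Function.Injective (mapW φ : Matrix m m R × Matrix m m R → _) := by
  rintro ⟨a, b⟩ ⟨c, d⟩ h
  rw [mapW, mapW, Prod.mk.injEq] at h
  exact Prod.ext (Matrix.map_injective hφ h.1) (Matrix.map_injective hφ h.2)

lemma mapW_mapW {T : Type*} [CommRing T] (φ : R →+* S) (ψ : S →+* T)
    (w : Matrix m m R × Matrix m m R) : mapW ψ (mapW φ w) = mapW (ψ.comp φ) w := by
  simp [mapW, Matrix.map_map]

end Action

section BlockPairs

variable {R S : Type*} [CommRing R] [CommRing S] {n : ℕ}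

/-- Square matrices in block form with blocks of sizes `n` and `n + 1`. -/
abbrev BMat (n : ℕ) (R : Type*) : Type _ := Matrix (Fin n ⊕ Fin (n+1)) (Fin n ⊕ Fin (n+1)) R

/-- Pairs of symmetric matrices with vanishing top left block. -/
structure IsBlockPair (w : BMat n R × BMat n R) : Prop where
  symm_fst : w.1.IsSymm
  symm_snd : w.2.IsSymm
  zero_fst : w.1.toBlocks₁₁ = 0
  zero_snd : w.2.toBlocks₁₁ = 0

/-- The dehomogenised invariant form. -/
noncomputable def invPoly (w : BMat n R × BMat n R) : Polynomial R :=
  (-1) ^ n * (pencil w.1 w.2).det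

lemma invPoly_act {g : BMat n R} (hg : g.det = 1) (w : BMat n R × BMat n R) :
    invPoly (act g w) = invPoly w := by
  have h : (g.map Polynomial.C).det = 1 := by
    rw [← RingHom.mapMatrix_apply, ← RingHom.map_det, hg, map_one]
  rw [invPoly, invPoly, act, ← pencil_mul, ← mul_pencil, det_mul, det_mul, transpose_map,
    det_transpose, h, one_mul, mul_one]

lemma invPoly_mapW (φ : R →+* S) (w : BMat n R × BMat n R) :
    invPoly (mapW φ w) = (invPoly w).map φ := by
  have h := RingHom.map_det (Polynomial.mapRingHom φ) (pencil w.1 w.2)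
  rw [RingHom.mapMatrix_apply, pencil_map, Polynomial.coe_mapRingHom] at h
  rw [invPoly, invPoly, mapW, Polynomial.map_mul, h]
  simp

lemma IsBlockPair.exists_eq {w : BMat n R × BMat n R} (hw : IsBlockPair w) :
    ∃ (A B : Matrix (Fin n) (Fin (n+1)) R) (SA SB : Matrix (Fin (n+1)) (Fin (n+1)) R),
      SA.IsSymm ∧ SB.IsSymm ∧ w = (fromBlocks 0 A Aᵀ SA, fromBlocks 0 B Bᵀ SB) := by
  have key : ∀ N : BMat n R, N.IsSymm → N.toBlocks₁₁ = 0 →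
      N.toBlocks₂₂.IsSymm ∧ N = fromBlocks 0 N.toBlocks₁₂ N.toBlocks₁₂ᵀ N.toBlocks₂₂ := by
    intro N h1 h2
    rw [← fromBlocks_toBlocks N, isSymm_fromBlocks_iff] at h1
    refine ⟨h1.2.2.2, ?_⟩
    rw [h1.2.1, ← h2, fromBlocks_toBlocks]
  obtain ⟨hA, hA'⟩ := key _ hw.symm_fst hw.zero_fst
  obtain ⟨hB, hB'⟩ := key _ hw.symm_snd hw.zero_snd
  exact ⟨_, _, _, _, hA, hB, Prod.ext hA' hB'⟩

lemma isBlockPair_mk {A B : Matrix (Fin n) (Fin (n+1)) R} {SA SB : Matrix (Fin (n+1)) (Fin (n+1)) R}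
    (hA : SA.IsSymm) (hB : SB.IsSymm) :
    IsBlockPair (fromBlocks 0 A Aᵀ SA, fromBlocks 0 B Bᵀ SB) where
  symm_fst := isSymm_fromBlocks_iff.mpr ⟨transpose_zero, rfl, transpose_transpose A, hA⟩
  symm_snd := isSymm_fromBlocks_iff.mpr ⟨transpose_zero, rfl, transpose_transpose B, hB⟩
  zero_fst := toBlocks_fromBlocks₁₁ ..
  zero_snd := toBlocks_fromBlocks₁₁ ..

lemma invPoly_mk (A B : Matrix (Fin n) (Fin (n+1)) R) (SA SB : Matrix (Fin (n+1)) (Fin (n+1)) R) :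
    invPoly (fromBlocks 0 A Aᵀ SA, fromBlocks 0 B Bᵀ SB) =
      (pencil SA SB *ᵥ minorVec (pencil A B)) ⬝ᵥ minorVec (pencil A B) := by
  have h : pencil (fromBlocks 0 A Aᵀ SA) (fromBlocks 0 B Bᵀ SB) =
      fromBlocks 0 (pencil A B) (pencil A B)ᵀ (pencil SA SB) := by
    ext1 i j
    rcases i with i | i <;> rcases j with j | j <;> simp [pencil_apply]
  rw [invPoly, h, det_bordered, ← mul_assoc, ← pow_add, Even.neg_one_pow ⟨n, rfl⟩, one_mul]

lemma fromBlocks_congr (a : Matrix (Fin n) (Fin n) R) (u : Matrix (Fin (n+1)) (Fin n) R)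
    (d : Matrix (Fin (n+1)) (Fin (n+1)) R) (A : Matrix (Fin n) (Fin (n+1)) R)
    (T : Matrix (Fin (n+1)) (Fin (n+1)) R) :
    fromBlocks a 0 u d * fromBlocks 0 A Aᵀ T * (fromBlocks a 0 u d)ᵀ =
      fromBlocks 0 (a * A * dᵀ) (a * A * dᵀ)ᵀ (d * T * dᵀ + (u * A * dᵀ + (u * A * dᵀ)ᵀ)) := by
  rw [fromBlocks_transpose, fromBlocks_multiply, fromBlocks_multiply]
  simp only [Matrix.mul_zero, Matrix.zero_mul, add_zero, zero_add, transpose_zero, transpose_mul,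
    transpose_transpose, Matrix.mul_assoc, Matrix.add_mul]
  congr 1
  abel

lemma IsBlockPair.act {g : BMat n R} (hg : g ∈ parab (Fin n) (Fin (n+1)) R)
    {w : BMat n R × BMat n R} (hw : IsBlockPair w) : IsBlockPair (act g w) := by
  obtain ⟨A, B, SA, SB, hA, hB, rfl⟩ := hw.exists_eq
  obtain ⟨a, u, d, rfl, -⟩ := exists_eq_fromBlocks hg
  have key : ∀ (A : Matrix (Fin n) (Fin (n+1)) R) {T : Matrix (Fin (n+1)) (Fin (n+1)) R},
      T.IsSymm → (d * T * dᵀ + (u * A * dᵀ + (u * A * dᵀ)ᵀ)).IsSymm := by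
    intro A T hT
    refine IsSymm.add ?_ (isSymm_add_transpose_self _)
    rw [IsSymm, transpose_mul, transpose_mul, transpose_transpose, hT.eq, Matrix.mul_assoc]
  rw [LocalGlobal.act, fromBlocks_congr, fromBlocks_congr]
  exact isBlockPair_mk (key A hA) (key B hB)

lemma isBlockPair_mapW_iff {φ : R →+* S} (hφ : Function.Injective φ) {w : BMat n R × BMat n R} :
    IsBlockPair (mapW φ w) ↔ IsBlockPair w := by
  have h1 : ∀ N : BMat n R, (N.map φ).IsSymm ↔ N.IsSymm := fun N => by
    rw [IsSymm, IsSymm, ← transpose_map, (Matrix.map_injective hφ).eq_iff]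
  have h2 : ∀ N : BMat n R, (N.map φ).toBlocks₁₁ = 0 ↔ N.toBlocks₁₁ = 0 := fun N => by
    rw [← (Matrix.map_injective hφ).eq_iff, Matrix.map_zero _ (map_zero φ)]
    rfl
  constructor
  · rintro ⟨a, b, c, d⟩
    exact ⟨(h1 _).mp a, (h1 _).mp b, (h2 _).mp c, (h2 _).mp d⟩
  · rintro ⟨a, b, c, d⟩
    exact ⟨(h1 _).mpr a, (h1 _).mpr b, (h2 _).mpr c, (h2 _).mpr d⟩

/-- The coefficient matrix of the minors of the off-diagonal blocks of a pair. -/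
noncomputable def offMat (w : BMat n R × BMat n R) : Matrix (Fin (n+1)) (Fin (n+1)) R :=
  coeffMat w.1.toBlocks₁₂ w.2.toBlocks₁₂

lemma offMat_mapW (φ : R →+* S) (w : BMat n R × BMat n R) :
    offMat (mapW φ w) = (offMat w).map φ :=
  coeffMat_map φ _ _

theorem det_offMat_ne_zero {K : Type*} [Field K] {w : BMat n K × BMat n K} (hw : IsBlockPair w)
    (hsf : Squarefree (invPoly w)) (hdeg : 2 * n ≤ (invPoly w).natDegree) :
    (offMat w).det ≠ 0 := by
  obtain ⟨A, B, SA, SB, hA, hB, rfl⟩ := hw.exists_eq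
  rw [invPoly_mk] at hsf hdeg
  rw [offMat, toBlocks_fromBlocks₁₂, toBlocks_fromBlocks₁₂]
  refine det_coeffMat_ne_zero A B _ (fun i j => ?_) hsf hdeg
  rw [pencil_apply]
  compute_degree

/-- The standard pair with given invariant form. -/
noncomputable def stdPair (n : ℕ) (F : Polynomial R) : BMat n R × BMat n R :=
  (fromBlocks 0 (stdA R n) (stdA R n)ᵀ (diagonal fun i => F.coeff (2 * (i : ℕ) + 1)),
    fromBlocks 0 (stdB R n) (stdB R n)ᵀ (diagonal fun i => -F.coeff (2 * (i : ℕ))))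

lemma isBlockPair_stdPair (F : Polynomial R) : IsBlockPair (stdPair n F) :=
  isBlockPair_mk (isSymm_diagonal _) (isSymm_diagonal _)

lemma mapW_stdPair (φ : R →+* S) (F : Polynomial R) :
    mapW φ (stdPair n F) = stdPair n (F.map φ) := by
  have hA : (stdA R n).map φ = stdA S n := by
    ext i j
    simp only [map_apply, stdA, of_apply]
    split_ifs <;> simp
  have hB : (stdB R n).map φ = stdB S n := by
    ext i j
    simp only [map_apply, stdB, of_apply]
    split_ifs <;> simp
  simp [mapW, stdPair, fromBlocks_map, hA, hB, transpose_map, diagonal_map, Matrix.map_zero]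

lemma pencil_diagonal_powVec {F : Polynomial R} (hF : F.natDegree ≤ 2 * n + 1) :
    (pencil (diagonal fun i : Fin (n+1) => F.coeff (2 * (i : ℕ) + 1))
      (diagonal fun i => -F.coeff (2 * (i : ℕ))) *ᵥ powVec R n) ⬝ᵥ powVec R n = F := by
  have h1 : ∀ (f : ℕ → Polynomial R) (l : ℕ),
      ∑ j ∈ Finset.range (2 * l), f j = ∑ j ∈ Finset.range l, (f (2 * j) + f (2 * j + 1)) := by
    intro f l
    induction l with
    | zero => simp
    | succ l ih =>
      rw [Finset.sum_range_succ, ← ih, Nat.mul_succ, Finset.sum_range_succ, Finset.sum_range_succ,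
        add_assoc]
  have h2 : pencil (diagonal fun i : Fin (n+1) => F.coeff (2 * (i : ℕ) + 1))
      (diagonal fun i => -F.coeff (2 * (i : ℕ))) = diagonal fun i : Fin (n+1) =>
        Polynomial.X * Polynomial.C (F.coeff (2 * (i : ℕ) + 1)) +
          Polynomial.C (F.coeff (2 * (i : ℕ))) := by
    ext1 i j
    rw [pencil_apply]
    by_cases h : i = j
    · subst h; simp
    · simp [h]
  conv_rhs => rw [F.as_sum_range_C_mul_X_pow' (n := 2 * (n + 1)) (by omega), h1, Finset.sum_range]
  rw [h2, dotProduct]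
  refine Finset.sum_congr rfl fun i _ => ?_
  rw [mulVec_diagonal, powVec]
  ring

lemma invPoly_stdPair {F : Polynomial R} (hF : F.natDegree ≤ 2 * n + 1) :
    invPoly (stdPair n F) = F := by
  rw [stdPair, invPoly_mk, minorVec_std, pencil_diagonal_powVec hF]

/-- A pair whose coefficient matrix is invertible is equivalent to the standard pair. -/
theorem exists_act_stdPair {w : BMat n R × BMat n R} (hw : IsBlockPair w) {F : Polynomial R}
    (hF : F.natDegree ≤ 2 * n + 1) (hinv : invPoly w = F) (hunit : IsUnit (offMat w).det) :
    ∃ g ∈ parab (Fin n) (Fin (n+1)) R, act g (stdPair n F) = w := by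
  obtain ⟨A, B, SA, SB, hA, hB, rfl⟩ := hw.exists_eq
  rw [offMat, toBlocks_fromBlocks₁₂, toBlocks_fromBlocks₁₂] at hunit
  rw [invPoly_mk] at hinv
  obtain ⟨H, hHA, hHB⟩ := exists_mul_coeffMat A B
  have hdet := det_eq_det_coeffMat A B hunit H hHA hHB
  have hv := minorVec_pencil_eq A B
  set V := coeffMat A B
  have hVW : V * V⁻¹ = 1 := mul_nonsing_inv _ hunit
  have hsymm : ∀ {T : Matrix (Fin (n+1)) (Fin (n+1)) R} (_ : T.IsSymm) (c : Fin (n+1) → R),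
      (Vᵀ * T * V - diagonal c).IsSymm := by
    intro T hT c
    refine IsSymm.sub ?_ (isSymm_diagonal _)
    rw [IsSymm, transpose_mul, transpose_mul, transpose_transpose, hT.eq, Matrix.mul_assoc]
  have hpen : ∀ C D C' D' : Matrix (Fin (n+1)) (Fin (n+1)) R,
      pencil (C - C') (D - D') = pencil C D - pencil C' D' := by
    intro C D C' D'
    ext1 i j
    simp only [pencil_apply, Matrix.sub_apply, map_sub]
    ring
  obtain ⟨u, huA, huB⟩ := exists_add_transpose_eq
    (Vᵀ * SA * V - diagonal fun i : Fin (n+1) => F.coeff (2 * (i : ℕ) + 1))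
    (Vᵀ * SB * V - diagonal fun i : Fin (n+1) => -F.coeff (2 * (i : ℕ))) (hsymm hA _) (hsymm hB _) (by
      rw [hpen, sub_mulVec, sub_dotProduct, pencil_diagonal_powVec hF, ← hinv, sub_eq_zero, hv,
        ← pencil_mul, ← mul_pencil, ← mulVec_mulVec, ← mulVec_mulVec, transpose_map,
        mulVec_transpose, ← dotProduct_mulVec])
  let x : Matrix (Fin (n+1)) (Fin n) R := V⁻¹ᵀ * u
  refine ⟨fromBlocks H 0 x V⁻¹ᵀ, ?_, ?_⟩
  · rw [fromBlocks_mem_parab, det_transpose, hdet, ← det_mul, hVW, det_one]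
  · have key : ∀ (N : Matrix (Fin n) (Fin (n+1)) R) (M T D : Matrix (Fin (n+1)) (Fin (n+1)) R),
        M + Mᵀ = Vᵀ * T * V - D → u * N = M →
        V⁻¹ᵀ * D * V⁻¹ᵀᵀ + (V⁻¹ᵀ * u * N * V⁻¹ᵀᵀ + (V⁻¹ᵀ * u * N * V⁻¹ᵀᵀ)ᵀ) = T := by
      intro N M T D h1 h2
      have h3 : V⁻¹ᵀ * (Vᵀ * T * V) * V⁻¹ = T := by
        rw [Matrix.mul_assoc Vᵀ, ← Matrix.mul_assoc, ← transpose_mul, hVW, transpose_one,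
          Matrix.one_mul, Matrix.mul_assoc, hVW, Matrix.mul_one]
      have h4 : (V⁻¹ᵀ * M * V⁻¹)ᵀ = V⁻¹ᵀ * Mᵀ * V⁻¹ := by
        rw [transpose_mul, transpose_mul, transpose_transpose, Matrix.mul_assoc]
      rw [Matrix.mul_assoc _ u, h2, transpose_transpose, h4, ← Matrix.add_mul, ← Matrix.mul_add,
        h1, ← Matrix.add_mul, ← Matrix.mul_add, add_sub_cancel, h3]
    rw [act, stdPair, fromBlocks_congr, fromBlocks_congr, key _ _ SA _ huA rfl,
      key _ _ SB _ huB rfl, transpose_transpose, ← hHA, ← hHB, Matrix.mul_assoc, Matrix.mul_assoc,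
      hVW, Matrix.mul_one, Matrix.mul_one]

lemma eq_one_of_act_stdPair {F : Polynomial R} {g : BMat n R}
    (hg : g ∈ parab (Fin n) (Fin (n+1)) R) (h : act g (stdPair n F) = stdPair n F) : g = 1 := by
  obtain ⟨a, u, d, rfl, hdet⟩ := exists_eq_fromBlocks hg
  rw [act, stdPair, fromBlocks_congr, fromBlocks_congr, Prod.mk.injEq, fromBlocks_inj,
    fromBlocks_inj] at h
  obtain ⟨⟨-, hA, -, hSA⟩, -, hB, -, hSB⟩ := h
  have h1 := mulVec_minorVec_mul (a.map Polynomial.C) (pencil (stdA R n) (stdB R n))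
    (dᵀ.map Polynomial.C)
  have hdetC : ∀ {l : ℕ} (N : Matrix (Fin l) (Fin l) R),
      (N.map Polynomial.C).det = Polynomial.C N.det := fun N => by
    rw [RingHom.map_det, RingHom.mapMatrix_apply]
  rw [mul_pencil, pencil_mul, hA, hB, minorVec_std, hdetC, hdetC, det_transpose, ← map_mul, hdet,
    map_one, one_smul] at h1
  have hd : d = 1 := by
    have h2 : dᵀ = 1 := by
      apply map_C_mulVec_powVec_injective
      rw [h1, Matrix.map_one _ (map_zero _) (map_one _), one_mulVec]
    rw [← transpose_transpose d, h2, transpose_one]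
  subst hd
  rw [transpose_one, Matrix.mul_one] at hA
  have ha : a = 1 := by
    ext i j
    have h3 := congrFun (congrFun hA i) j.castSucc
    rw [mul_stdA_castSucc] at h3
    rw [← neg_neg (a i j), h3, stdA, of_apply, one_apply]
    by_cases hij : i = j
    · simp [hij]
    · simp [hij, Ne.symm hij, Fin.castSucc_inj]
  subst ha
  have hu := eq_zero_of_add_transpose_eq_zero u (by simpa using hSA) (by simpa using hSB)
  rw [hu, fromBlocks_one]

theorem eq_of_act_stdPair {F : Polynomial R} {g h : BMat n R}
    (hg : g ∈ parab (Fin n) (Fin (n+1)) R) (hh : h ∈ parab (Fin n) (Fin (n+1)) R)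
    (heq : act g (stdPair n F) = act h (stdPair n F)) : g = h := by
  have h1 : h.adjugate * g = 1 := by
    refine eq_one_of_act_stdPair (F := F) (mul_mem (adjugate_mem_parab hh) hg) ?_
    rw [act_mul, heq, ← act_mul, parab_adjugate_mul hh, act_one]
  calc g = h * h.adjugate * g := by rw [parab_mul_adjugate hh, Matrix.one_mul]
    _ = h := by rw [Matrix.mul_assoc, h1, Matrix.mul_one]

end BlockPairs

end LocalGlobal

namespace LocalGlobal

section Elementary

variable (m k K : Type*) [Fintype m] [Fintype k] [DecidableEq m] [DecidableEq k] [Field K]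

/-- The group generated by the elementary block lower triangular transvections. -/
def elem : Submonoid (Matrix (m ⊕ k) (m ⊕ k) K) :=
  Submonoid.closure {g | ∃ i j, i ≠ j ∧ (∀ c, transvection i j c ∈ parab m k K) ∧
    ∃ c, g = transvection i j c}

variable {m k K}

lemma transvection_mem_elem {i j : m ⊕ k} (hij : i ≠ j)
    (h : ∀ a b, i = Sum.inl a → j ≠ Sum.inr b) (c : K) : transvection i j c ∈ elem m k K := by
  refine Submonoid.subset_closure ⟨i, j, hij, fun c => ⟨?_, det_transvection_of_ne i j hij c⟩, c, rfl⟩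
  ext a b
  have : ¬(i = Sum.inl a ∧ j = Sum.inr b) := fun h' => h a b h'.1 h'.2
  simp [toBlocks₁₂, transvection, single_apply, this]

lemma fromBlocks_transvec_prod_mem_elem (L : List (TransvectionStruct m K)) :
    fromBlocks (L.map TransvectionStruct.toMatrix).prod 0 0 1 ∈ elem m k K := by
  induction L with
  | nil => simp
  | cons t L ih =>
    have h1 : fromBlocks t.toMatrix 0 0 (1 : Matrix k k K) ∈ elem m k K := by
      rw [← TransvectionStruct.toMatrix_sumInl]
      exact transvection_mem_elem (t.sumInl k).hij (by simp [TransvectionStruct.sumInl]) _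
    simpa [fromBlocks_multiply] using mul_mem h1 ih

lemma fromBlocks_one_transvec_prod_mem_elem (L : List (TransvectionStruct k K)) :
    fromBlocks 1 0 0 (L.map TransvectionStruct.toMatrix).prod ∈ elem m k K := by
  induction L with
  | nil => simp
  | cons t L ih =>
    have h1 : fromBlocks (1 : Matrix m m K) 0 0 t.toMatrix ∈ elem m k K := by
      have h2 : fromBlocks (1 : Matrix m m K) 0 0 t.toMatrix =
          transvection (Sum.inr t.i) (Sum.inr t.j) t.c := by
        rw [TransvectionStruct.toMatrix, transvection, transvection]
        ext a b
        rcases a with a | a <;> rcases b with b | b <;> simp [one_apply, single_apply]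
      rw [h2]
      exact transvection_mem_elem (by simpa using t.hij) (by simp) _
    simpa [fromBlocks_multiply] using mul_mem h1 ih

lemma fromBlocks_one_one_mem_elem (u : Matrix k m K) : fromBlocks 1 0 u 1 ∈ elem m k K := by
  induction u using Matrix.induction_on' with
  | h_zero => simp
  | h_add p q hp hq => simpa [fromBlocks_multiply] using mul_mem hp hq
  | h_std_basis i j x =>
    have h2 : fromBlocks (1 : Matrix m m K) 0 (single i j x) 1 =
        transvection (Sum.inr i) (Sum.inl j) x := by
      rw [transvection]
      ext a b
      rcases a with a | a <;> rcases b with b | b <;> simp [one_apply, single_apply]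
    rw [h2]
    exact transvection_mem_elem (by simp) (by simp) _

lemma exists_mul_diagonal_eq {e : Matrix (m ⊕ k) (m ⊕ k) K} (he : e ∈ elem m k K)
    (d : m ⊕ k → K) (hd : ∀ i, d i ≠ 0) : ∃ e' ∈ elem m k K, e * diagonal d = diagonal d * e' := by
  induction he using Submonoid.closure_induction with
  | mem x hx =>
    obtain ⟨i, j, hij, hmem, c, rfl⟩ := hx
    refine ⟨transvection i j ((d i)⁻¹ * c * d j),
      Submonoid.subset_closure ⟨i, j, hij, hmem, _, rfl⟩, ?_⟩
    ext a b
    rw [mul_diagonal, diagonal_mul, transvection, transvection, Matrix.add_apply, Matrix.add_apply,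
      single_apply, single_apply, one_apply]
    by_cases hab : i = a ∧ j = b
    · obtain ⟨rfl, rfl⟩ := hab
      have := hd i
      simp [hij]
      field_simp
    · simp only [if_neg hab, add_zero]
      by_cases h : a = b
      · simp [h]
      · simp [h]
  | one => exact ⟨1, one_mem _, by simp⟩
  | mul x y _ _ hx hy =>
    obtain ⟨x', hx', hx⟩ := hx
    obtain ⟨y', hy', hy⟩ := hy
    exact ⟨x' * y', mul_mem hx' hy', by rw [Matrix.mul_assoc, hy, ← Matrix.mul_assoc, hx,
      Matrix.mul_assoc]⟩

/-- A block lower triangular matrix is a diagonal matrix times elementary ones. -/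
theorem exists_eq_diagonal_mul {h : Matrix (m ⊕ k) (m ⊕ k) K} (hh : h ∈ parab m k K) :
    ∃ d : m ⊕ k → K, ∏ i, d i = 1 ∧ ∃ e ∈ elem m k K, h = diagonal d * e := by
  obtain ⟨a, u, b, rfl, hdet⟩ := exists_eq_fromBlocks hh
  obtain ⟨L, L', D, hD⟩ := Pivot.exists_list_transvec_mul_diagonal_mul_list_transvec a
  obtain ⟨M, M', E, hE⟩ := Pivot.exists_list_transvec_mul_diagonal_mul_list_transvec b
  have haunit : IsUnit a.det := IsUnit.of_mul_eq_one _ hdet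
  have hprod : ∏ i, Sum.elim D E i = 1 := by
    rw [Fintype.prod_sum_type, ← hdet, hD, hE]
    simp [det_mul, TransvectionStruct.det_toMatrix_prod]
  have hne : ∀ i, Sum.elim D E i ≠ 0 := by
    intro i hi
    rw [Finset.prod_eq_zero (Finset.mem_univ i) hi] at hprod
    exact zero_ne_one hprod
  set l := (L.map TransvectionStruct.toMatrix).prod with hl
  set l' := (L'.map TransvectionStruct.toMatrix).prod with hl'
  set r := (M.map TransvectionStruct.toMatrix).prod with hr
  set r' := (M'.map TransvectionStruct.toMatrix).prod with hr'
  have h1 : fromBlocks a 0 u b = fromBlocks 1 0 (u * a⁻¹) 1 *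
      (fromBlocks l 0 0 1 * fromBlocks 1 0 0 r) * diagonal (Sum.elim D E) *
        (fromBlocks l' 0 0 1 * fromBlocks 1 0 0 r') := by
    rw [← fromBlocks_diagonal]
    simp only [fromBlocks_multiply, Matrix.mul_zero, Matrix.zero_mul, add_zero, zero_add,
      Matrix.one_mul, Matrix.mul_one]
    have h2 : u * a⁻¹ * l * diagonal D * l' = u := by
      rw [Matrix.mul_assoc, Matrix.mul_assoc, Matrix.mul_assoc, ← Matrix.mul_assoc l, ← hD,
        nonsing_inv_mul a haunit, Matrix.mul_one]
    rw [h2, ← hD, ← hE]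
  obtain ⟨e, he, h3⟩ := exists_mul_diagonal_eq (mul_mem (fromBlocks_one_one_mem_elem (u * a⁻¹))
    (mul_mem (fromBlocks_transvec_prod_mem_elem L) (fromBlocks_one_transvec_prod_mem_elem M)))
    (Sum.elim D E) hne
  refine ⟨Sum.elim D E, hprod, e * (fromBlocks l' 0 0 1 * fromBlocks 1 0 0 r'),
    mul_mem he (mul_mem (fromBlocks_transvec_prod_mem_elem L')
      (fromBlocks_one_transvec_prod_mem_elem M')), ?_⟩
  rw [h1, h3, Matrix.mul_assoc]

end Elementary

section Approximation

/-- The rational numbers that are integral at `p`. -/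
noncomputable def ratInt (p : ℕ) [Fact p.Prime] : Subring ℚ :=
  (PadicInt.subring p).comap (Rat.castHom ℚ_[p])

lemma norm_zpow_eq_one {p q : ℕ} [Fact p.Prime] [hq : Fact q.Prime] (hpq : q ≠ p) (e : ℤ) :
    ‖(((p : ℚ) ^ e : ℚ) : ℚ_[q])‖ = 1 := by
  rw [Rat.cast_zpow, Rat.cast_natCast, norm_zpow, Padic.norm_natCast_eq_one_iff.mpr
    ((Nat.coprime_primes hq.out Fact.out).mpr hpq), _root_.one_zpow]

lemma exists_zpow_mul {p : ℕ} [hp : Fact p.Prime] {x : ℚ_[p]} (hx : x ≠ 0) :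
    ∃ e : ℤ, ‖x * ((((p : ℚ) ^ e)⁻¹ : ℚ) : ℚ_[p])‖ = 1 := by
  refine ⟨x.valuation, ?_⟩
  have hp0 : (p : ℝ) ≠ 0 := by exact_mod_cast hp.out.ne_zero
  rw [norm_mul, Padic.norm_eq_zpow_neg_valuation hx, Rat.cast_inv, Rat.cast_zpow, Rat.cast_natCast,
    norm_inv, norm_zpow, Padic.norm_p, _root_.inv_zpow, inv_inv, _root_.zpow_neg, inv_mul_cancel₀]
  exact zpow_ne_zero _ hp0

/-- Strong approximation for the additive group. -/
lemma exists_rat_approx {p : ℕ} [hp : Fact p.Prime] (a : ℚ_[p]) {ε : ℝ} (hε : 0 < ε) :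
    ∃ r : ℚ, ‖a - r‖ < ε ∧ ∀ (q : ℕ) [Fact q.Prime], q ≠ p → r ∈ ratInt q := by
  by_cases ha : a = 0
  · exact ⟨0, by simpa [ha] using hε, fun q _ _ => zero_mem _⟩
  obtain ⟨e, he⟩ := exists_zpow_mul ha
  set c : ℚ := (p : ℚ) ^ e with hc
  have hc0 : c ≠ 0 := zpow_ne_zero _ (by exact_mod_cast hp.out.ne_zero)
  have hc0' : (c : ℚ_[p]) ≠ 0 := by exact_mod_cast hc0
  set z : ℤ_[p] := ⟨a * ((c⁻¹ : ℚ) : ℚ_[p]), he.le⟩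
  obtain ⟨k, hk⟩ := PadicInt.denseRange_natCast.exists_dist_lt z
    (div_pos hε (norm_pos_iff.mpr hc0'))
  rw [dist_eq_norm, PadicInt.norm_def, lt_div_iff₀ (norm_pos_iff.mpr hc0'), ← norm_mul] at hk
  refine ⟨k * c, ?_, fun q _ hq => mul_mem (natCast_mem _ k) ?_⟩
  · have h1 : a - ((k * c : ℚ) : ℚ_[p]) = ((z - k : ℤ_[p]) : ℚ_[p]) * c := by
      rw [PadicInt.coe_sub, PadicInt.coe_natCast, sub_mul]
      simp only [z]
      push_cast
      rw [inv_mul_cancel_right₀ hc0']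
    rw [h1]
    exact hk
  · exact (norm_zpow_eq_one hq e).le

end Approximation

section Decomposition

variable {m k : Type*} [Fintype m] [Fintype k] [DecidableEq m] [DecidableEq k]

lemma adjugate_mem_matrix {R : Type*} [CommRing R] (S : Subring R) {N : Matrix m m R}
    (hN : N ∈ S.matrix) : N.adjugate ∈ S.matrix := by
  have h1 : N = S.subtype.mapMatrix (Matrix.of fun i j => (⟨N i j, hN i j⟩ : S)) := rfl
  rw [h1, ← RingHom.map_adjugate]
  intro i j
  exact Subtype.property _

variable (m k) in
/-- The products of an integral matrix with a rational one that is integral away from `p`. -/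
def decomp (p : ℕ) [Fact p.Prime] : Set (Matrix (m ⊕ k) (m ⊕ k) ℚ_[p]) :=
  {h | ∃ κ ∈ parab m k ℚ_[p], κ ∈ (PadicInt.subring p).matrix ∧ ∃ δ ∈ parab m k ℚ,
    (∀ (q : ℕ) [Fact q.Prime], q ≠ p → δ ∈ (ratInt q).matrix) ∧
      h = κ * δ.map (Rat.castHom ℚ_[p])}

variable {p : ℕ} [hp : Fact p.Prime]

lemma mul_mem_decomp {κ h : Matrix (m ⊕ k) (m ⊕ k) ℚ_[p]} (hκ : κ ∈ parab m k ℚ_[p])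
    (hκ' : κ ∈ (PadicInt.subring p).matrix) (hh : h ∈ decomp m k p) : κ * h ∈ decomp m k p := by
  obtain ⟨κ₁, h1, h2, δ, h3, h4, rfl⟩ := hh
  exact ⟨κ * κ₁, mul_mem hκ h1, mul_mem hκ' h2, δ, h3, h4, (Matrix.mul_assoc _ _ _).symm⟩

lemma mul_transvection_mem_decomp {h : Matrix (m ⊕ k) (m ⊕ k) ℚ_[p]} (hh : h ∈ decomp m k p)
    {i j : m ⊕ k} (hij : i ≠ j) (hmem : ∀ c, transvection i j c ∈ parab m k ℚ_[p]) (a : ℚ_[p]) :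
    h * transvection i j a ∈ decomp m k p := by
  obtain ⟨κ, h1, h2, δ, h3, h4, rfl⟩ := hh
  rw [Matrix.mul_assoc]
  refine mul_mem_decomp h1 h2 ?_
  set δ' := δ.map (Rat.castHom ℚ_[p])
  have hδ' : δ' ∈ parab m k ℚ_[p] := map_mem_parab _ h3
  set N := δ' * single i j 1 * δ'.adjugate with hN
  set C : ℝ := ∑ x, ∑ y, ‖N x y‖ + 1
  have hCx : ∀ x, 0 ≤ ∑ y, ‖N x y‖ := fun x => Finset.sum_nonneg fun y _ => norm_nonneg _
  have hC0 : 0 < C := by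
    have := Finset.sum_nonneg fun x (_ : x ∈ Finset.univ) => hCx x
    linarith
  have hC : ∀ x y, ‖N x y‖ ≤ C := by
    intro x y
    have e1 := Finset.single_le_sum (fun y _ => norm_nonneg (N x y)) (Finset.mem_univ y)
    have e2 := Finset.single_le_sum (fun x _ => hCx x) (Finset.mem_univ x)
    linarith
  obtain ⟨r, hr, hr'⟩ := exists_rat_approx a (ε := C⁻¹) (inv_pos.mpr hC0)
  have htr : ∀ c : ℚ, (transvection i j c).map (Rat.castHom ℚ_[p]) =
      transvection i j (c : ℚ_[p]) := by
    intro c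
    rw [transvection, transvection, Matrix.map_add _ (map_add _), Matrix.map_one _ (map_zero _)
      (map_one _), map_single]
    rfl
  have hsplit : δ' * transvection i j a =
      (δ' * transvection i j (a - r) * δ'.adjugate) * (δ * transvection i j r).map
        (Rat.castHom ℚ_[p]) := by
    rw [Matrix.map_mul, htr, Matrix.mul_assoc, ← Matrix.mul_assoc δ'.adjugate,
      parab_adjugate_mul hδ', Matrix.one_mul, Matrix.mul_assoc,
      transvection_mul_transvection_same i j hij, sub_add_cancel]
  refine ⟨_, mul_mem (mul_mem hδ' (hmem _)) (adjugate_mem_parab hδ'), ?_, _,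
    mul_mem h3 (mem_parab_of_map (Rat.castHom ℚ_[p]).injective (by rw [htr]; exact hmem r)),
    fun q _ hq => mul_mem (h4 q hq) ?_, hsplit⟩
  · have hexp : δ' * transvection i j (a - r) * δ'.adjugate = 1 + (a - r) • N := by
      have : single i j (a - r) = (a - r) • single i j (1 : ℚ_[p]) := by simp
      rw [transvection, this, Matrix.mul_add, Matrix.mul_one, Matrix.add_mul,
        parab_mul_adjugate hδ', Matrix.mul_smul, Matrix.smul_mul]
    rw [hexp]
    refine add_mem (one_mem _) fun x y => ?_
    change ‖(a - r) * N x y‖ ≤ 1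
    rw [norm_mul]
    calc ‖a - r‖ * ‖N x y‖ ≤ C⁻¹ * C := by gcongr; exact hC x y
      _ = 1 := inv_mul_cancel₀ hC0.ne'
  · refine add_mem (one_mem _) fun x y => ?_
    rw [single_apply]
    split_ifs
    · exact hr' q hq
    · exact zero_mem _

lemma diagonal_mem_decomp {d : m ⊕ k → ℚ_[p]} (hd : ∏ i, d i = 1) :
    diagonal d ∈ decomp m k p := by
  have hne : ∀ i, d i ≠ 0 := by
    intro i hi
    rw [Finset.prod_eq_zero (Finset.mem_univ i) hi] at hd
    exact zero_ne_one hd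
  choose e he using fun i => exists_zpow_mul (hne i)
  have hp0 : (p : ℚ) ≠ 0 := by exact_mod_cast hp.out.ne_zero
  have hdiag : ∀ {K : Type} [Field K] (d : m ⊕ k → K), ∏ i, d i = 1 →
      diagonal d ∈ parab m k K := by
    intro K _ d hd
    refine ⟨?_, by rw [det_diagonal, hd]⟩
    ext i j
    simp [toBlocks₁₂]
  have hprod : ∏ i, (p : ℚ) ^ e i = 1 := by
    have h1 : ∏ i, ‖d i * ((((p : ℚ) ^ e i)⁻¹ : ℚ) : ℚ_[p])‖ = 1 :=
      Finset.prod_eq_one fun i _ => he i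
    have h2 : ∀ i, ‖((((p : ℚ) ^ e i)⁻¹ : ℚ) : ℚ_[p])‖ = ((((p : ℚ) ^ e i) : ℚ) : ℝ) := by
      intro i
      push_cast
      rw [norm_inv, norm_zpow, Padic.norm_p, _root_.inv_zpow, inv_inv]
    simp_rw [norm_mul, h2] at h1
    rw [Finset.prod_mul_distrib, ← norm_prod, hd, norm_one, one_mul, ← Rat.cast_prod] at h1
    exact_mod_cast h1
  refine ⟨diagonal fun i => d i * ((((p : ℚ) ^ e i)⁻¹ : ℚ) : ℚ_[p]), hdiag _ ?_, ?_,
    diagonal fun i => (p : ℚ) ^ e i, hdiag _ hprod, ?_, ?_⟩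
  · rw [Finset.prod_mul_distrib, hd, one_mul, ← Rat.cast_prod, Finset.prod_inv_distrib, hprod]
    simp
  · intro i j
    rw [diagonal_apply]
    split_ifs
    · exact (he i).le
    · exact zero_mem _
  · intro q _ hq i j
    rw [diagonal_apply]
    split_ifs
    · exact (norm_zpow_eq_one hq _).le
    · exact zero_mem _
  · rw [diagonal_map (map_zero _), diagonal_mul_diagonal]
    congr 1
    funext i
    simp only [Rat.coe_castHom, mul_assoc, ← Rat.cast_mul]
    rw [inv_mul_cancel₀ (zpow_ne_zero _ hp0), Rat.cast_one, mul_one]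

theorem mem_decomp {h : Matrix (m ⊕ k) (m ⊕ k) ℚ_[p]} (hh : h ∈ parab m k ℚ_[p]) :
    h ∈ decomp m k p := by
  obtain ⟨d, hd, e, he, rfl⟩ := exists_eq_diagonal_mul hh
  have h1 := diagonal_mem_decomp hd
  clear hh
  induction he using Submonoid.closure_induction_right with
  | one => simpa using h1
  | mul_right x hx y hy ih =>
    obtain ⟨i, j, hij, hmem, c, rfl⟩ := hy
    rw [← Matrix.mul_assoc]
    exact mul_transvection_mem_decomp ih hij hmem c

lemma exists_rat_parab_finset (h : ∀ (p : ℕ) [Fact p.Prime], Matrix (m ⊕ k) (m ⊕ k) ℚ_[p])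
    (hh : ∀ (p : ℕ) [Fact p.Prime], h p ∈ parab m k ℚ_[p]) (s : Finset ℕ) :
    ∃ γ ∈ parab m k ℚ, ∀ (q : ℕ) [Fact q.Prime],
      (q ∉ s → γ ∈ (ratInt q).matrix) ∧ (q ∈ s → ∃ κ ∈ parab m k ℚ_[q],
        κ ∈ (PadicInt.subring q).matrix ∧ h q = κ * γ.map (Rat.castHom ℚ_[q])) := by
  induction s using Finset.induction_on with
  | empty => exact ⟨1, one_mem _, fun q _ => ⟨fun _ => one_mem _, by simp⟩⟩
  | insert p s hps ih =>
    obtain ⟨γ, hγ, ih⟩ := ih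
    by_cases hp : p.Prime
    · have : Fact p.Prime := ⟨hp⟩
      have hγp : γ.map (Rat.castHom ℚ_[p]) ∈ parab m k ℚ_[p] := map_mem_parab _ hγ
      obtain ⟨κ, h1, h2, δ, h3, h4, h5⟩ :=
        mem_decomp (mul_mem (hh p) (adjugate_mem_parab hγp))
      refine ⟨δ * γ, mul_mem h3 hγ, fun q _ => ⟨fun hq => ?_, fun hq => ?_⟩⟩
      · rw [Finset.mem_insert, not_or] at hq
        exact mul_mem (h4 q hq.1) ((ih q).1 hq.2)
      · by_cases hqp : q = p
        · subst hqp
          refine ⟨κ, h1, h2, ?_⟩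
          rw [Matrix.map_mul, ← Matrix.mul_assoc, ← h5, Matrix.mul_assoc, parab_adjugate_mul hγp,
            Matrix.mul_one]
        · obtain ⟨κ', h1', h2', h5'⟩ := (ih q).2 (Finset.mem_of_mem_insert_of_ne hq hqp)
          have hδq : δ.map (Rat.castHom ℚ_[q]) ∈ parab m k ℚ_[q] := map_mem_parab _ h3
          refine ⟨κ' * (δ.map (Rat.castHom ℚ_[q])).adjugate, mul_mem h1' (adjugate_mem_parab hδq),
            mul_mem h2' (adjugate_mem_matrix _ (h4 q hqp)), ?_⟩
          rw [Matrix.map_mul, Matrix.mul_assoc, ← Matrix.mul_assoc _ _ (γ.map _),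
            parab_adjugate_mul hδq, Matrix.one_mul, h5']
    · refine ⟨γ, hγ, fun q hq => ⟨fun h => (ih q).1 fun h' => h (Finset.mem_insert_of_mem h'),
        fun h => (ih q).2 (Finset.mem_of_mem_insert_of_ne h ?_)⟩⟩
      rintro rfl
      exact hp hq.out

/-- The class number of the parabolic group is one. -/
theorem exists_rat_parab (h : ∀ (p : ℕ) [Fact p.Prime], Matrix (m ⊕ k) (m ⊕ k) ℚ_[p])
    (hh : ∀ (p : ℕ) [Fact p.Prime], h p ∈ parab m k ℚ_[p]) (s : Finset ℕ)
    (hs : ∀ (p : ℕ) [Fact p.Prime], p ∉ s → h p ∈ (PadicInt.subring p).matrix) :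
    ∃ γ ∈ parab m k ℚ, ∀ (q : ℕ) [Fact q.Prime], ∃ κ ∈ parab m k ℚ_[q],
      κ ∈ (PadicInt.subring q).matrix ∧ h q = κ * γ.map (Rat.castHom ℚ_[q]) := by
  obtain ⟨γ, hγ, h1⟩ := exists_rat_parab_finset h hh s
  refine ⟨γ, hγ, fun q _ => ?_⟩
  by_cases hq : q ∈ s
  · exact (h1 q).2 hq
  · have hγq : γ.map (Rat.castHom ℚ_[q]) ∈ parab m k ℚ_[q] := map_mem_parab _ hγ
    refine ⟨h q * (γ.map (Rat.castHom ℚ_[q])).adjugate, mul_mem (hh q) (adjugate_mem_parab hγq),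
      mul_mem (hs q hq) (adjugate_mem_matrix _ ((h1 q).1 hq)), ?_⟩
    rw [Matrix.mul_assoc, parab_adjugate_mul hγq, Matrix.mul_one]

end Decomposition

end LocalGlobal

namespace LocalGlobal

section Descent

lemma exists_int_of_forall_norm_le_one {x : ℚ} (h : ∀ (p : ℕ) [Fact p.Prime], ‖(x : ℚ_[p])‖ ≤ 1) :
    ∃ z : ℤ, (z : ℚ) = x := by
  refine ⟨x.num, Rat.coe_int_num_of_den_eq_one ?_⟩
  by_contra hx
  obtain ⟨p, hp, hpx⟩ := Nat.exists_prime_and_dvd hx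
  have : Fact p.Prime := ⟨hp⟩
  have h1 := Rat.padicValuation_le_one_iff.mp
    ((Padic.norm_rat_le_one_iff_padicValuation_le_one p).mp (h p))
  exact h1 hpx

lemma exists_int_matrix {m k : Type*} {M : Matrix m k ℚ}
    (h : ∀ (p : ℕ) [Fact p.Prime], ∃ Z : Matrix m k ℤ_[p],
      Z.map PadicInt.Coe.ringHom = M.map (Rat.castHom ℚ_[p])) :
    ∃ Z : Matrix m k ℤ, Z.map (Int.castRingHom ℚ) = M := by
  have h1 : ∀ i j, ∃ z : ℤ, (z : ℚ) = M i j := fun i j =>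
    exists_int_of_forall_norm_le_one fun p _ => by
      obtain ⟨Z, hZ⟩ := h p
      have h2 : ((Z i j : ℤ_[p]) : ℚ_[p]) = (M i j : ℚ) := congrFun (congrFun hZ i) j
      rw [← h2]
      exact PadicInt.norm_le_one _
  choose Z hZ using h1
  exact ⟨of Z, by ext i j; exact hZ i j⟩

lemma exists_int_mapW {m : Type*} {w : Matrix m m ℚ × Matrix m m ℚ}
    (h : ∀ (p : ℕ) [Fact p.Prime], ∃ z : Matrix m m ℤ_[p] × Matrix m m ℤ_[p],
      mapW PadicInt.Coe.ringHom z = mapW (Rat.castHom ℚ_[p]) w) :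
    ∃ z : Matrix m m ℤ × Matrix m m ℤ, mapW (Int.castRingHom ℚ) z = w := by
  obtain ⟨a, ha⟩ := exists_int_matrix (M := w.1) fun p _ =>
    (h p).imp' Prod.fst fun z hz => congrArg Prod.fst hz
  obtain ⟨b, hb⟩ := exists_int_matrix (M := w.2) fun p _ =>
    (h p).imp' Prod.snd fun z hz => congrArg Prod.snd hz
  exact ⟨(a, b), Prod.ext ha hb⟩

lemma exists_padicInt_matrix {p : ℕ} [Fact p.Prime] {m : Type*} [Fintype m] [DecidableEq m]
    {M : Matrix m m ℚ_[p]}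
    (h : M ∈ (PadicInt.subring p).matrix) : ∃ Z : Matrix m m ℤ_[p], Z.map PadicInt.Coe.ringHom = M :=
  ⟨of fun i j => ⟨M i j, h i j⟩, by ext i j; rfl⟩

lemma coe_ringHom_injective (p : ℕ) [Fact p.Prime] :
    Function.Injective (PadicInt.Coe.ringHom : ℤ_[p] →+* ℚ_[p]) :=
  Subtype.coe_injective

lemma exists_finset_squarefree_map {F : Polynomial ℤ}
    (hF : Squarefree (F.map (Int.castRingHom ℚ))) :
    ∃ s : Finset ℕ, ∀ (p : ℕ) [Fact p.Prime], p ∉ s →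
      Squarefree (F.map (Int.castRingHom (ZMod p))) ∧
        (F.map (Int.castRingHom (ZMod p))).natDegree = F.natDegree := by
  have hF0 : F ≠ 0 := by
    rintro rfl
    exact hF.ne_zero (Polynomial.map_zero _)
  obtain ⟨a, b, hab⟩ := PerfectField.separable_iff_squarefree.mpr hF
  obtain ⟨c, hc, hca⟩ := IsLocalization.integerNormalization_spec (nonZeroDivisors ℤ) a
  obtain ⟨d, hd, hdb⟩ := IsLocalization.integerNormalization_spec (nonZeroDivisors ℤ) b
  set A := IsLocalization.integerNormalization (nonZeroDivisors ℤ) a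
  set B := IsLocalization.integerNormalization (nonZeroDivisors ℤ) b
  have key : Polynomial.C d * A * F + Polynomial.C c * B * Polynomial.derivative F =
      Polynomial.C (c * d) := by
    refine Polynomial.map_injective (Int.castRingHom ℚ) Int.cast_injective ?_
    rw [algebraMap_int_eq] at hca hdb
    rw [Polynomial.map_add, Polynomial.map_mul, Polynomial.map_mul, Polynomial.map_mul,
      Polynomial.map_mul, hca, hdb, ← Polynomial.derivative_map, Polynomial.map_C, Polynomial.map_C,
      Polynomial.map_C, zsmul_eq_mul, zsmul_eq_mul]
    simp only [eq_intCast, Int.cast_mul, Polynomial.C_mul, map_intCast]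
    linear_combination ((c : Polynomial ℚ) * d) * hab
  have hN : c * d * F.leadingCoeff ≠ 0 :=
    mul_ne_zero (mul_ne_zero (nonZeroDivisors.ne_zero hc) (nonZeroDivisors.ne_zero hd))
      (Polynomial.leadingCoeff_ne_zero.mpr hF0)
  refine ⟨(c * d * F.leadingCoeff).natAbs.primeFactors, fun p hp hps => ?_⟩
  have hne : (Int.castRingHom (ZMod p)) (c * d * F.leadingCoeff) ≠ 0 := by
    intro h0
    refine hps (Nat.mem_primeFactors.mpr ⟨hp.out, ?_, Int.natAbs_ne_zero.mpr hN⟩)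
    rw [eq_intCast, ZMod.intCast_zmod_eq_zero_iff_dvd] at h0
    exact Int.natCast_dvd.mp h0
  rw [map_mul] at hne
  refine ⟨Polynomial.Separable.squarefree ?_,
    Polynomial.natDegree_map_of_leadingCoeff_ne_zero _ (right_ne_zero_of_mul hne)⟩
  have hcd := left_ne_zero_of_mul hne
  have key2 := congrArg (Polynomial.map (Int.castRingHom (ZMod p))) key
  rw [Polynomial.map_add, Polynomial.map_mul, Polynomial.map_mul (q := Polynomial.derivative F),
    ← Polynomial.derivative_map, Polynomial.map_C] at key2
  refine ⟨Polynomial.C ((Int.castRingHom (ZMod p)) (c * d))⁻¹ *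
    (Polynomial.C d * A).map (Int.castRingHom (ZMod p)),
    Polynomial.C ((Int.castRingHom (ZMod p)) (c * d))⁻¹ *
    (Polynomial.C c * B).map (Int.castRingHom (ZMod p)), ?_⟩
  rw [_root_.mul_assoc, _root_.mul_assoc, ← _root_.mul_add, key2, ← Polynomial.C_mul, inv_mul_cancel₀ hcd,
    Polynomial.C_1]

end Descent

section BlockForm

variable {n : ℕ}

lemma IsBlockPair.mapW {R S : Type*} [CommRing R] [CommRing S] (φ : R →+* S)
    {w : BMat n R × BMat n R} (hw : IsBlockPair w) : IsBlockPair (mapW φ w) := by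
  obtain ⟨a, b, c, d⟩ := hw
  refine ⟨?_, ?_, ?_, ?_⟩
  · exact a.map φ
  · exact b.map φ
  · exact (congrArg (fun N => Matrix.map N φ) c).trans (Matrix.map_zero _ (map_zero φ))
  · exact (congrArg (fun N => Matrix.map N φ) d).trans (Matrix.map_zero _ (map_zero φ))

lemma isUnit_of_toZMod_ne_zero {p : ℕ} [Fact p.Prime] {x : ℤ_[p]} (hx : PadicInt.toZMod x ≠ 0) :
    IsUnit x := by
  rw [← IsLocalRing.notMem_maximalIdeal, ← PadicInt.ker_toZMod, RingHom.mem_ker]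
  exact hx

lemma exists_act_stdPair_of_field {K : Type*} [Field K] {w : BMat n K × BMat n K}
    (hw : IsBlockPair w) {F : Polynomial K} (hF : F.natDegree ≤ 2 * n + 1)
    (hF' : 2 * n ≤ F.natDegree) (hsf : Squarefree F) (hinv : invPoly w = F) :
    ∃ g ∈ parab (Fin n) (Fin (n+1)) K, act g (stdPair n F) = w :=
  exists_act_stdPair hw hF hinv (isUnit_iff_ne_zero.mpr
    (det_offMat_ne_zero hw (hinv ▸ hsf) (hinv ▸ hF')))

lemma exists_act_stdPair_padicInt {p : ℕ} [Fact p.Prime] {F : Polynomial ℤ}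
    (hF : F.natDegree ≤ 2 * n + 1) (hF' : 2 * n ≤ F.natDegree)
    (hsf : Squarefree (F.map (Int.castRingHom (ZMod p))))
    (hdeg : (F.map (Int.castRingHom (ZMod p))).natDegree = F.natDegree)
    {w : BMat n ℤ_[p] × BMat n ℤ_[p]} (hw : IsBlockPair w)
    (hinv : invPoly w = F.map (Int.castRingHom ℤ_[p])) :
    ∃ g ∈ parab (Fin n) (Fin (n+1)) ℤ_[p], act g (stdPair n (F.map (Int.castRingHom ℤ_[p]))) = w := by
  refine exists_act_stdPair hw (Polynomial.natDegree_map_le.trans hF) hinv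
    (isUnit_of_toZMod_ne_zero ?_)
  have h1 : invPoly (mapW (PadicInt.toZMod (p := p)) w) = F.map (Int.castRingHom (ZMod p)) := by
    rw [invPoly_mapW, hinv, Polynomial.map_map]
    exact congrArg (fun φ => F.map φ) (RingHom.ext_int _ _)
  have h2 := det_offMat_ne_zero (hw.mapW PadicInt.toZMod) (h1 ▸ hsf) (by rw [h1, hdeg]; exact hF')
  rwa [offMat_mapW, ← RingHom.mapMatrix_apply, ← RingHom.map_det] at h2

lemma exists_local_stdPair {F : Polynomial ℤ}
    (hF : F.natDegree ≤ 2 * n + 1) (hF' : 2 * n ≤ F.natDegree)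
    (hsf : Squarefree (F.map (Int.castRingHom ℚ)))
    {p : ℕ} [Fact p.Prime] {w : BMat n ℤ_[p] × BMat n ℤ_[p]} (hw : IsBlockPair w)
    (hinv : invPoly w = F.map (Int.castRingHom ℤ_[p])) :
    ∃ g ∈ parab (Fin n) (Fin (n+1)) ℚ_[p],
      act g (stdPair n (F.map (Int.castRingHom ℚ_[p]))) = mapW PadicInt.Coe.ringHom w := by
  have h0 : F.map (Int.castRingHom ℚ_[p]) = (F.map (Int.castRingHom ℚ)).map (Rat.castHom ℚ_[p]) := by
    rw [Polynomial.map_map]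
    exact congrArg (fun φ => F.map φ) (RingHom.ext_int _ _)
  refine exists_act_stdPair_of_field (hw.mapW _) (Polynomial.natDegree_map_le.trans hF) ?_ ?_ ?_
  · rwa [Polynomial.natDegree_map_eq_of_injective (Int.castRingHom ℚ_[p]).injective_int]
  · rw [h0]
    exact (PerfectField.separable_iff_squarefree.mpr hsf).map.squarefree
  · rw [invPoly_mapW, hinv, Polynomial.map_map]
    exact congrArg (fun φ => F.map φ) (RingHom.ext_int _ _)

lemma mapW_coe_mapW_int {p : ℕ} [Fact p.Prime] (w : BMat n ℤ × BMat n ℤ) :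
    mapW PadicInt.Coe.ringHom (mapW (Int.castRingHom ℤ_[p]) w) =
      mapW (Rat.castHom ℚ_[p]) (mapW (Int.castRingHom ℚ) w) := by
  rw [mapW_mapW, mapW_mapW]
  exact congrArg (fun φ => mapW φ w) (RingHom.ext_int _ _)

lemma mapW_stdPair_rat (p : ℕ) [Fact p.Prime] (F : Polynomial ℤ) :
    mapW (Rat.castHom ℚ_[p]) (stdPair n (F.map (Int.castRingHom ℚ))) =
      stdPair n (F.map (Int.castRingHom ℚ_[p])) := by
  rw [mapW_stdPair, Polynomial.map_map]
  exact congrArg (fun φ => stdPair n (F.map φ)) (RingHom.ext_int _ _)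

theorem exists_global_pair {F : Polynomial ℤ}
    (hF : F.natDegree ≤ 2 * n + 1) (hF' : 2 * n ≤ F.natDegree)
    (hsf : Squarefree (F.map (Int.castRingHom ℚ)))
    (wp : ∀ (p : ℕ) [Fact p.Prime], BMat n ℤ_[p] × BMat n ℤ_[p])
    (hwp : ∀ (p : ℕ) [Fact p.Prime], IsBlockPair (wp p) ∧
      invPoly (wp p) = F.map (Int.castRingHom ℤ_[p])) :
    ∃ w : BMat n ℤ × BMat n ℤ, IsBlockPair w ∧ invPoly w = F ∧
      ∀ (p : ℕ) [Fact p.Prime], ∃ g ∈ parab (Fin n) (Fin (n+1)) ℤ_[p],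
        act g (mapW (Int.castRingHom ℤ_[p]) w) = wp p := by
  obtain ⟨s, hs⟩ := exists_finset_squarefree_map hsf
  have hloc : ∀ (p : ℕ) [Fact p.Prime], ∃ h : BMat n ℚ_[p],
      h ∈ parab (Fin n) (Fin (n+1)) ℚ_[p] ∧
      act h (stdPair n (F.map (Int.castRingHom ℚ_[p]))) = mapW PadicInt.Coe.ringHom (wp p) ∧
      (p ∉ s → h ∈ (PadicInt.subring p).matrix) := by
    intro p _
    by_cases hp : p ∈ s
    · obtain ⟨h, h1, h2⟩ := exists_local_stdPair hF hF' hsf (hwp p).1 (hwp p).2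
      exact ⟨h, h1, h2, fun h => absurd hp h⟩
    · obtain ⟨g, h1, h2⟩ := exists_act_stdPair_padicInt hF hF' (hs p hp).1 (hs p hp).2
        (hwp p).1 (hwp p).2
      refine ⟨g.map PadicInt.Coe.ringHom, map_mem_parab _ h1, ?_, fun _ i j => (g i j).2⟩
      rw [← h2, mapW_act, mapW_stdPair, Polynomial.map_map]
      exact congrArg (fun φ => act _ (stdPair n (F.map φ))) (RingHom.ext_int _ _)
  choose h hpar hact hmat using hloc
  obtain ⟨γ, hγ, hκ⟩ := exists_rat_parab h hpar s hmat
  have hK : ∀ (q : ℕ) [Fact q.Prime], ∃ K ∈ parab (Fin n) (Fin (n+1)) ℤ_[q],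
      act (K.map PadicInt.Coe.ringHom) (mapW (Rat.castHom ℚ_[q])
        (act γ (stdPair n (F.map (Int.castRingHom ℚ))))) = mapW PadicInt.Coe.ringHom (wp q) := by
    intro q _
    obtain ⟨κ, hκ1, hκ2, hκ3⟩ := hκ q
    obtain ⟨K, rfl⟩ := exists_padicInt_matrix hκ2
    refine ⟨K, mem_parab_of_map (coe_ringHom_injective q) hκ1, ?_⟩
    rw [mapW_act, ← act_mul, ← hκ3, mapW_stdPair_rat, hact]
  obtain ⟨w, hw⟩ := exists_int_mapW (w := act γ (stdPair n (F.map (Int.castRingHom ℚ))))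
    fun q _ => by
      obtain ⟨K, hK1, hK2⟩ := hK q
      refine ⟨act K.adjugate (wp q), ?_⟩
      rw [mapW_act, ← hK2, ← act_mul, ← Matrix.map_mul, parab_adjugate_mul hK1,
        Matrix.map_one _ (map_zero _) (map_one _), act_one]
  refine ⟨w, ?_, ?_, fun p _ => ?_⟩
  · rw [← isBlockPair_mapW_iff (φ := Int.castRingHom ℚ) Int.cast_injective, hw]
    exact IsBlockPair.act hγ (isBlockPair_stdPair _)
  · refine Polynomial.map_injective (Int.castRingHom ℚ) Int.cast_injective ?_
    rw [← invPoly_mapW, hw, invPoly_act hγ.2,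
      invPoly_stdPair (Polynomial.natDegree_map_le.trans hF)]
  · obtain ⟨K, hK1, hK2⟩ := hK p
    refine ⟨K, hK1, mapW_injective (coe_ringHom_injective p) ?_⟩
    rw [mapW_act, mapW_coe_mapW_int, hw, hK2]

theorem exists_act_eq_of_local {F : Polynomial ℤ}
    (hF : F.natDegree ≤ 2 * n + 1) (hF' : 2 * n ≤ F.natDegree)
    (hsf : Squarefree (F.map (Int.castRingHom ℚ)))
    {w w' : BMat n ℤ × BMat n ℤ} (hw : IsBlockPair w) (hw' : IsBlockPair w')
    (hinv : invPoly w = F) (hinv' : invPoly w' = F)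
    (hloc : ∀ (p : ℕ) [Fact p.Prime], ∃ g ∈ parab (Fin n) (Fin (n+1)) ℤ_[p],
      ∃ g' ∈ parab (Fin n) (Fin (n+1)) ℤ_[p],
        act g (mapW (Int.castRingHom ℤ_[p]) w) = act g' (mapW (Int.castRingHom ℤ_[p]) w')) :
    ∃ γ ∈ parab (Fin n) (Fin (n+1)) ℤ, act γ w = w' := by
  have hstd : ∀ v : BMat n ℤ × BMat n ℤ, IsBlockPair v → invPoly v = F →
      ∃ x ∈ parab (Fin n) (Fin (n+1)) ℚ, act x (stdPair n (F.map (Int.castRingHom ℚ))) =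
        mapW (Int.castRingHom ℚ) v := fun v hv hvF =>
    exists_act_stdPair_of_field (hv.mapW _) (Polynomial.natDegree_map_le.trans hF)
      (by rwa [Polynomial.natDegree_map_eq_of_injective (Int.castRingHom ℚ).injective_int]) hsf
      (by rw [invPoly_mapW, hvF])
  obtain ⟨x, hx, hxw⟩ := hstd w hw hinv
  obtain ⟨x', hx', hxw'⟩ := hstd w' hw' hinv'
  obtain ⟨Γ, hΓ⟩ := exists_int_matrix (M := x' * x.adjugate) fun p _ => by
    obtain ⟨g, hg, g', hg', hgg⟩ := hloc p
    refine ⟨g'.adjugate * g, ?_⟩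
    have h1 := congrArg (mapW PadicInt.Coe.ringHom) hgg
    rw [mapW_act, mapW_act, mapW_coe_mapW_int, mapW_coe_mapW_int, ← hxw, ← hxw', mapW_act,
      mapW_act, mapW_stdPair_rat, ← act_mul, ← act_mul] at h1
    have h2 := eq_of_act_stdPair (mul_mem (map_mem_parab _ hg) (map_mem_parab _ hx))
      (mul_mem (map_mem_parab _ hg') (map_mem_parab _ hx')) h1
    have e1 : (x.map (Rat.castHom ℚ_[p])) * (x.adjugate.map (Rat.castHom ℚ_[p])) = 1 := by
      rw [← Matrix.map_mul, parab_mul_adjugate hx, Matrix.map_one _ (map_zero _) (map_one _)]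
    have e2 : (g'.adjugate.map PadicInt.Coe.ringHom) * (g'.map PadicInt.Coe.ringHom) = 1 := by
      rw [← Matrix.map_mul, parab_adjugate_mul hg', Matrix.map_one _ (map_zero _) (map_one _)]
    rw [Matrix.map_mul, Matrix.map_mul]
    calc (g'.adjugate.map PadicInt.Coe.ringHom) * (g.map PadicInt.Coe.ringHom)
        = (g'.adjugate.map PadicInt.Coe.ringHom) * (g.map PadicInt.Coe.ringHom *
            x.map (Rat.castHom ℚ_[p])) * (x.adjugate.map (Rat.castHom ℚ_[p])) := by
          rw [Matrix.mul_assoc, Matrix.mul_assoc, e1, Matrix.mul_one]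
      _ = x'.map (Rat.castHom ℚ_[p]) * (x.adjugate.map (Rat.castHom ℚ_[p])) := by
          rw [h2, ← Matrix.mul_assoc, e2, Matrix.one_mul]
  refine ⟨Γ, mem_parab_of_map (φ := Int.castRingHom ℚ) Int.cast_injective ?_,
    mapW_injective (φ := Int.castRingHom ℚ) Int.cast_injective ?_⟩
  · rw [hΓ]
    exact mul_mem hx' (adjugate_mem_parab hx)
  · rw [mapW_act, hΓ, ← hxw, ← act_mul, Matrix.mul_assoc, parab_adjugate_mul hx, Matrix.mul_one, hxw']

end BlockForm

end LocalGlobal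

namespace LocalGlobal

section Dehomogenization

variable {R : Type*} [CommRing R]

/-- The univariate polynomial `f(X, 1)` of a binary form `f(x, y)`. -/
noncomputable def dehom (f : MvPolynomial (Fin 2) R) : Polynomial R :=
  MvPolynomial.aeval ![Polynomial.X, 1] f

lemma dehom_map {S : Type*} [CommRing S] (φ : R →+* S) (f : MvPolynomial (Fin 2) R) :
    dehom (MvPolynomial.map φ f) = (dehom f).map φ := by
  induction f using MvPolynomial.induction_on with
  | C a => simp [dehom]
  | add p q hp hq =>
    rw [map_add, dehom, map_add, ← dehom, ← dehom, hp, hq, ← Polynomial.map_add, dehom, dehom, dehom,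
      map_add]
  | mul_X p i hp =>
    rw [map_mul, dehom, map_mul, ← dehom, hp, dehom, dehom, map_mul, Polynomial.map_mul,
      MvPolynomial.map_X, MvPolynomial.aeval_X, MvPolynomial.aeval_X]
    fin_cases i <;> simp

lemma eq_of_dehom_eq {N : ℕ} {f g : MvPolynomial (Fin 2) R} (hf : f.IsHomogeneous N)
    (hg : g.IsHomogeneous N) (h : dehom f = dehom g) : f = g :=
  (Polynomial.homogenize_eq_of_isHomogeneous hf h).symm.trans
    (Polynomial.homogenize_eq_of_isHomogeneous hg rfl)

lemma natDegree_dehom_le {N : ℕ} {f : MvPolynomial (Fin 2) R} (hf : f.IsHomogeneous N) :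
    (dehom f).natDegree ≤ N := by
  rw [dehom, f.as_sum, map_sum]
  refine Polynomial.natDegree_sum_le_of_forall_le _ _ fun m hm => ?_
  have h1 : m 0 + m 1 = N := by
    have h2 : m.weight 1 = N := hf (by simpa using hm)
    simpa [Finsupp.weight_apply, Finsupp.sum_fintype, Fin.sum_univ_two] using h2
  rw [MvPolynomial.aeval_monomial, Finsupp.prod_fintype _ _ (by simp), Fin.prod_univ_two,
    ← Polynomial.C_eq_algebraMap]
  refine (Polynomial.natDegree_C_mul_le _ _).trans ?_
  simp only [Matrix.cons_val_zero, Matrix.cons_val_one, one_pow, mul_one]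
  exact (Polynomial.natDegree_X_pow_le _).trans (by omega)

lemma eq_homogenize_mul {N : ℕ} {f : MvPolynomial (Fin 2) R} (hf : f.IsHomogeneous N) :
    f = (dehom f).homogenize (dehom f).natDegree * MvPolynomial.X 1 ^ (N - (dehom f).natDegree) := by
  rw [← Polynomial.homogenize_one, ← Polynomial.homogenize_mul _ _ le_rfl (by simp), mul_one,
    Nat.add_sub_cancel' (natDegree_dehom_le hf)]
  exact (Polynomial.homogenize_eq_of_isHomogeneous hf rfl).symm

lemma squarefree_dehom {K : Type*} [Field K] {N : ℕ} {f : MvPolynomial (Fin 2) K}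
    (hf : f.IsHomogeneous N) (hsf : Squarefree f) : Squarefree (dehom f) := by
  intro d hd
  have hd0 : d ≠ 0 := by
    rintro rfl
    rw [mul_zero, zero_dvd_iff] at hd
    refine hsf.ne_zero ?_
    rw [← Polynomial.homogenize_eq_of_isHomogeneous hf rfl, ← dehom, hd, Polynomial.homogenize_zero]
  have h1 := Polynomial.homogenize_dvd hd
  rw [Polynomial.natDegree_mul hd0 hd0, Polynomial.homogenize_mul _ _ le_rfl le_rfl] at h1
  have h2 := (hsf _ (h1.trans (Dvd.intro _ (eq_homogenize_mul hf).symm))).map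
    (MvPolynomial.aeval ![Polynomial.X, (1 : Polynomial K)])
  rwa [Polynomial.aeval_homogenize_X_one _ le_rfl] at h2

lemma le_natDegree_dehom_add_one {K : Type*} [Field K] {N : ℕ} {f : MvPolynomial (Fin 2) K}
    (hf : f.IsHomogeneous N) (hsf : Squarefree f) : N ≤ (dehom f).natDegree + 1 := by
  by_contra! h
  have h1 : (MvPolynomial.X 1 * MvPolynomial.X 1 : MvPolynomial (Fin 2) K) ∣ f := by
    rw [← pow_two]
    exact (pow_dvd_pow _ (by omega)).trans (Dvd.intro_left _ (eq_homogenize_mul hf).symm)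
  have h2 := (hsf _ h1).map (MvPolynomial.aeval (0 : Fin 2 → K))
  simp at h2

end Dehomogenization

section Reindex

variable {n : ℕ}

/-- The splitting of `2n + 1` indices into the first `n` and the last `n + 1`. -/
def ix (n : ℕ) : Fin n ⊕ Fin (n+1) ≃ Fin (2*n+1) :=
  finSumFinEquiv.trans (finCongr (by omega))

lemma ix_inl (i : Fin n) : (ix n (Sum.inl i) : ℕ) = i := by simp [ix]

lemma ix_inr (i : Fin (n+1)) : (ix n (Sum.inr i) : ℕ) = n + i := by simp [ix]

lemma submatrix_ix_inj {R : Type*} {M N : Matrix (Fin (2*n+1)) (Fin (2*n+1)) R} :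
    M.submatrix (ix n) (ix n) = N.submatrix (ix n) (ix n) ↔ M = N :=
  (Matrix.reindex (ix n).symm (ix n).symm).apply_eq_iff_eq (x := M) (y := N)

/-- A pair of matrices in block form. -/
def toB {R : Type*} (w : MPair n R) : BMat n R × BMat n R :=
  (w.1.submatrix (ix n) (ix n), w.2.submatrix (ix n) (ix n))

lemma toB_injective {R : Type*} : Function.Injective (toB : MPair n R → _) := by
  intro v w h
  exact Prod.ext (submatrix_ix_inj.mp (congrArg Prod.fst h))
    (submatrix_ix_inj.mp (congrArg Prod.snd h))

lemma exists_toB_eq {R : Type*} (v : BMat n R × BMat n R) : ∃ w : MPair n R, toB w = v :=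
  ⟨(v.1.submatrix (ix n).symm (ix n).symm, v.2.submatrix (ix n).symm (ix n).symm), by simp [toB]⟩

variable {R : Type*} [CommRing R]

lemma toB_actPair (g : Matrix (Fin (2*n+1)) (Fin (2*n+1)) R) (w : MPair n R) :
    toB (actPair g w) = act (g.submatrix (ix n) (ix n)) (toB w) := by
  simp only [toB, actPair, act, Matrix.transpose_submatrix, Matrix.submatrix_mul_equiv]

lemma gnmem_iff {g : Matrix (Fin (2*n+1)) (Fin (2*n+1)) R} :
    GNmem n g ↔ g.submatrix (ix n) (ix n) ∈ parab (Fin n) (Fin (n+1)) R := by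
  rw [mem_parab, Matrix.det_submatrix_equiv_self, GNmem, and_comm]
  refine and_congr_left fun _ => ⟨fun h => ?_, fun h i j hi hj => ?_⟩
  · ext i j
    exact h _ _ (by rw [ix_inl]; exact i.2) (by rw [ix_inr]; omega)
  · obtain ⟨i, rfl⟩ := (ix n).surjective i
    obtain ⟨j, rfl⟩ := (ix n).surjective j
    cases i with
    | inr i => rw [ix_inr] at hi; omega
    | inl i =>
      cases j with
      | inl j => rw [ix_inl] at hj; omega
      | inr j => exact congrFun (congrFun h i) j

lemma exists_gnmem_iff {v w : MPair n R} :
    (∃ g : Matrix (Fin (2*n+1)) (Fin (2*n+1)) R, GNmem n g ∧ actPair g v = w) ↔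
      ∃ g ∈ parab (Fin n) (Fin (n+1)) R, act g (toB v) = toB w := by
  constructor
  · rintro ⟨g, hg, rfl⟩
    exact ⟨_, gnmem_iff.mp hg, (toB_actPair g v).symm⟩
  · rintro ⟨g, hg, h⟩
    have h1 : (g.submatrix (ix n).symm (ix n).symm).submatrix (ix n) (ix n) = g := by simp
    exact ⟨g.submatrix (ix n).symm (ix n).symm, gnmem_iff.mpr (h1.symm ▸ hg),
      toB_injective (by rw [toB_actPair, h1, h])⟩

lemma isSymm_submatrix_ix {R : Type*} {M : Matrix (Fin (2*n+1)) (Fin (2*n+1)) R} :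
    (M.submatrix (ix n) (ix n)).IsSymm ↔ M.IsSymm := by
  rw [Matrix.IsSymm, Matrix.IsSymm, Matrix.transpose_submatrix,
    submatrix_ix_inj]

lemma toBlocks₁₁_submatrix_ix {M : Matrix (Fin (2*n+1)) (Fin (2*n+1)) R} :
    (M.submatrix (ix n) (ix n)).toBlocks₁₁ = 0 ↔
      ∀ i j : Fin (2*n+1), (i : ℕ) < n → (j : ℕ) < n → M i j = 0 := by
  refine ⟨fun h i j hi hj => ?_, fun h => ?_⟩
  · obtain ⟨i, rfl⟩ := (ix n).surjective i
    obtain ⟨j, rfl⟩ := (ix n).surjective j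
    cases i with
    | inr i => rw [ix_inr] at hi; omega
    | inl i =>
      cases j with
      | inr j => rw [ix_inr] at hj; omega
      | inl j => exact congrFun (congrFun h i) j
  · ext i j
    exact h _ _ (by rw [ix_inl]; exact i.2) (by rw [ix_inl]; exact j.2)

lemma w0mem_iff {w : MPair n R} : W0mem n w ↔ IsBlockPair (toB w) := by
  constructor
  · rintro ⟨⟨h1, h2⟩, h3⟩
    exact ⟨isSymm_submatrix_ix.mpr h1, isSymm_submatrix_ix.mpr h2,
      toBlocks₁₁_submatrix_ix.mpr fun i j hi hj => (h3 i j hi hj).1,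
      toBlocks₁₁_submatrix_ix.mpr fun i j hi hj => (h3 i j hi hj).2⟩
  · rintro ⟨h1, h2, h3, h4⟩
    exact ⟨⟨isSymm_submatrix_ix.mp h1, isSymm_submatrix_ix.mp h2⟩, fun i j hi hj =>
      ⟨toBlocks₁₁_submatrix_ix.mp h3 i j hi hj, toBlocks₁₁_submatrix_ix.mp h4 i j hi hj⟩⟩

lemma dehom_invForm (w : MPair n R) : dehom (invForm n w) = invPoly (toB w) := by
  rw [dehom, invForm, map_mul, map_pow, map_neg, map_one, invPoly, AlgHom.map_det,
    ← Matrix.det_submatrix_equiv_self (ix n)]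
  congr 2
  ext i j : 2
  simp [pencil_apply, toB, Polynomial.C_eq_algebraMap]

lemma isHomogeneous_invForm (w : MPair n R) : (invForm n w).IsHomogeneous (2*n+1) := by
  have h1 : ((-1) ^ n : MvPolynomial (Fin 2) R).IsHomogeneous 0 := by
    have h := MvPolynomial.isHomogeneous_C (Fin 2) ((-1) ^ n : R)
    rwa [map_pow, map_neg, map_one] at h
  have h3 : ∀ {q : MvPolynomial (Fin 2) R}, q.IsHomogeneous (2*n+1) →
      ((-1) ^ n * q).IsHomogeneous (2*n+1) := fun hq => by simpa using h1.mul hq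
  rw [invForm, Matrix.det_apply]
  refine h3 (MvPolynomial.IsHomogeneous.sum _ _ _ fun σ _ => ?_)
  have h2 : (∏ i, Matrix.of (fun i j : Fin (2*n+1) => (MvPolynomial.X 0 * MvPolynomial.C (w.1 i j) -
      MvPolynomial.X 1 * MvPolynomial.C (w.2 i j) : MvPolynomial (Fin 2) R)) (σ i) i).IsHomogeneous
      (2*n+1) := by
    have h := MvPolynomial.IsHomogeneous.prod Finset.univ
      (fun i => Matrix.of (fun i j : Fin (2*n+1) => (MvPolynomial.X 0 * MvPolynomial.C (w.1 i j) -
      MvPolynomial.X 1 * MvPolynomial.C (w.2 i j) : MvPolynomial (Fin 2) R)) (σ i) i) (fun _ => 1)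
      fun i _ => ((MvPolynomial.isHomogeneous_X R 0).mul (MvPolynomial.isHomogeneous_C _ _)).sub
        ((MvPolynomial.isHomogeneous_X R 1).mul (MvPolynomial.isHomogeneous_C _ _))
    simpa using h
  rcases Int.units_eq_one_or (Equiv.Perm.sign σ) with h | h <;> rw [h]
  · rwa [one_smul]
  · rw [Units.neg_smul, one_smul]
    exact h2.neg

end Reindex

end LocalGlobal

/-- **Local-global principle for `G_N ↷ W_N^0` (Theorem 1.6).**
Let `f` be an integral binary `N`-ic form with nonzero discriminant (equivalently:
homogeneous of degree `N` and squarefree over `ℚ`), and for each prime `p` choose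
`(A_p, B_p) ∈ W_N^0(ℤ_p)` with `inv(A_p,B_p) = f`.  Then there is `(A,B) ∈ W_N^0(ℤ)`,
unique up to the action of `G_N(ℤ)`, with `inv(A,B) = f` and such that `(A,B)` is
`G_N(ℤ_p)`-equivalent to `(A_p,B_p)` for every prime `p`. -/
theorem local_global_GN_W0 (n : ℕ) (hn : 1 ≤ n)
    (f : MvPolynomial (Fin 2) ℤ) (hhom : f.IsHomogeneous (2*n+1))
    (hsf : Squarefree (MvPolynomial.map (Int.castRingHom ℚ) f))
    (wp : ∀ (p : ℕ) [Fact p.Prime], MPair n ℤ_[p])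
    (hwp : ∀ (p : ℕ) [Fact p.Prime], W0mem n (wp p) ∧
      invForm n (wp p) = MvPolynomial.map (Int.castRingHom ℤ_[p]) f) :
    ∃ w : MPair n ℤ,
      (W0mem n w ∧ invForm n w = f ∧
        ∀ (p : ℕ) [Fact p.Prime],
          ∃ g : Matrix (Fin (2*n+1)) (Fin (2*n+1)) ℤ_[p],
            GNmem n g ∧ actPair g (mapPair (Int.castRingHom ℤ_[p]) w) = wp p) ∧
      ∀ w' : MPair n ℤ,
        (W0mem n w' ∧ invForm n w' = f ∧
          ∀ (p : ℕ) [Fact p.Prime],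
            ∃ g : Matrix (Fin (2*n+1)) (Fin (2*n+1)) ℤ_[p],
              GNmem n g ∧ actPair g (mapPair (Int.castRingHom ℤ_[p]) w') = wp p) →
        ∃ γ : Matrix (Fin (2*n+1)) (Fin (2*n+1)) ℤ, GNmem n γ ∧ actPair γ w = w' := by
  set F := LocalGlobal.dehom f with hF
  have hmap := LocalGlobal.dehom_map (Int.castRingHom ℚ) f
  have hdeg : (F.map (Int.castRingHom ℚ)).natDegree = F.natDegree :=
    Polynomial.natDegree_map_eq_of_injective (Int.castRingHom ℚ).injective_int _
  have hsf' := LocalGlobal.squarefree_dehom (hhom.map _) hsf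
  have hle := LocalGlobal.natDegree_dehom_le hhom
  have hge := LocalGlobal.le_natDegree_dehom_add_one (hhom.map _) hsf
  rw [hmap] at hsf' hge
  rw [← hF, hdeg] at hge
  have hge' : 2 * n ≤ F.natDegree := by omega
  have hlocal : ∀ (v : MPair n ℤ), (∀ (p : ℕ) [Fact p.Prime],
      ∃ g : Matrix (Fin (2*n+1)) (Fin (2*n+1)) ℤ_[p],
        GNmem n g ∧ actPair g (mapPair (Int.castRingHom ℤ_[p]) v) = wp p) ↔
      ∀ (p : ℕ) [Fact p.Prime], ∃ g ∈ LocalGlobal.parab (Fin n) (Fin (n+1)) ℤ_[p],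
        LocalGlobal.act g (LocalGlobal.mapW (Int.castRingHom ℤ_[p]) (LocalGlobal.toB v)) =
          LocalGlobal.toB (wp p) := fun v =>
    forall₂_congr fun p _ => LocalGlobal.exists_gnmem_iff
  obtain ⟨v, hv, hvF, hvp⟩ := LocalGlobal.exists_global_pair hle hge' hsf'
    (fun p _ => LocalGlobal.toB (wp p)) fun p _ => ⟨LocalGlobal.w0mem_iff.mp (hwp p).1, by
      rw [← LocalGlobal.dehom_invForm, (hwp p).2, LocalGlobal.dehom_map]⟩
  obtain ⟨w, rfl⟩ := LocalGlobal.exists_toB_eq v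
  refine ⟨w, ⟨LocalGlobal.w0mem_iff.mpr hv, LocalGlobal.eq_of_dehom_eq
    (LocalGlobal.isHomogeneous_invForm w) hhom ((LocalGlobal.dehom_invForm w).trans hvF),
    (hlocal w).mpr hvp⟩, fun w' ⟨hw', hwF', hwp'⟩ => ?_⟩
  refine LocalGlobal.exists_gnmem_iff.mpr (LocalGlobal.exists_act_eq_of_local hle hge' hsf' hv
    (LocalGlobal.w0mem_iff.mp hw') hvF (by rw [← LocalGlobal.dehom_invForm, hwF'])
    fun p _ => ?_)
  obtain ⟨g, hg, hgw⟩ := hvp p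
  obtain ⟨g', hg', hgw'⟩ := (hlocal w').mp hwp' p
  exact ⟨g, hg, g', hg', hgw.trans hgw'.symm⟩
end

section
/- The λ-invariant satisfies λ(g·(A,B)) = λ(A,B) for all g ∈ (SL_n × SL_{n+1})(K) and (A,B) ∈ W_N^top(K). Moreover, for every subfield K ⊆ ℂ and every λ₀ ∈ K^×, the set {(A,B) ∈ W_N^top(K) : λ(A,B) = λ₀} is nonempty and (SL_n × SL_{n+1})(K) acts transitively on it, and the stabilizer in (SL_n × SL_{n+1})(K) of any element of this set is trivial. -/
open Matrix MvPolynomial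

/-- Membership in `W_N^top(R)`: symmetric pairs vanishing on the top-left `n × n` and
bottom-right `(n+1) × (n+1)` blocks. -/
def Wtopmem {R : Type*} [CommRing R] (n : ℕ) (w : MPair n R) : Prop :=
  WNmem n w ∧ ∀ i j : Fin (2*n+1),
    (((i : ℕ) < n ∧ (j : ℕ) < n) ∨ (n ≤ (i : ℕ) ∧ n ≤ (j : ℕ))) → w.1 i j = 0 ∧ w.2 i j = 0

/-- Membership in the block-diagonal subgroup `(SL_n × SL_{n+1})(R) ⊆ SL_N(R)`. -/
def SLnn1mem {R : Type*} [CommRing R] (n : ℕ) (g : Matrix (Fin (2*n+1)) (Fin (2*n+1)) R) :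
    Prop :=
  (∀ i j : Fin (2*n+1),
      (((i : ℕ) < n ∧ n ≤ (j : ℕ)) ∨ (n ≤ (i : ℕ) ∧ (j : ℕ) < n)) → g i j = 0) ∧
  Matrix.det (Matrix.of fun i j : Fin n => g (rowIdx n i) (rowIdx n j)) = 1 ∧
  Matrix.det (Matrix.of fun i j : Fin (n+1) => g (colIdx n i) (colIdx n j)) = 1

section Pencil

variable {R : Type*} {n : ℕ}

/-- The square matrix obtained from an `n × (n+1)` matrix by adding a first row `z`. -/
def consRow (z : Fin (n+1) → R) (M : Matrix (Fin n) (Fin (n+1)) R) :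
    Matrix (Fin (n+1)) (Fin (n+1)) R :=
  Matrix.of fun r c => Fin.cases (z c) (fun r => M r c) r

theorem consRow_zero (z : Fin (n+1) → R) (M : Matrix (Fin n) (Fin (n+1)) R) (c : Fin (n+1)) :
    consRow z M 0 c = z c := rfl

theorem consRow_succ (z : Fin (n+1) → R) (M : Matrix (Fin n) (Fin (n+1)) R) (r : Fin n)
    (c : Fin (n+1)) : consRow z M r.succ c = M r c := rfl

variable [CommRing R]

/-- The vector of signed maximal minors of an `n × (n+1)` matrix. -/
noncomputable def minorVec (M : Matrix (Fin n) (Fin (n+1)) R) (i : Fin (n+1)) : R :=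
  (-1) ^ (i : ℕ) * (M.submatrix id i.succAbove).det

theorem det_consRow_eq_dotProduct_minorVec (z : Fin (n+1) → R)
    (M : Matrix (Fin n) (Fin (n+1)) R) :
    (consRow z M).det = z ⬝ᵥ minorVec M := by
  rw [det_succ_row_zero]
  refine Finset.sum_congr rfl fun i _ => ?_
  have : (consRow z M).submatrix Fin.succ i.succAbove
      = M.submatrix id i.succAbove := by
    ext r c; simp only [submatrix_apply, consRow_succ, id]
  rw [this, minorVec]
  simp only [consRow_zero]
  ring

theorem mulVec_minorVec_self (M : Matrix (Fin n) (Fin (n+1)) R) : M *ᵥ minorVec M = 0 := by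
  ext r
  change M r ⬝ᵥ minorVec M = 0
  rw [← det_consRow_eq_dotProduct_minorVec]
  refine det_zero_of_row_eq (i := 0) (j := r.succ) (Fin.succ_ne_zero r).symm ?_
  ext c
  simp only [consRow_zero, consRow_succ]

theorem minorVec_mul_left (g : Matrix (Fin n) (Fin n) R) (M : Matrix (Fin n) (Fin (n+1)) R) :
    minorVec (g * M) = g.det • minorVec M := by
  ext i
  have : (g * M).submatrix id i.succAbove = g * M.submatrix id i.succAbove := by
    ext r c; simp [mul_apply]
  simp only [minorVec, this, det_mul, Pi.smul_apply, smul_eq_mul]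
  ring

theorem mulVec_minorVec_mul_right (M : Matrix (Fin n) (Fin (n+1)) R)
    (h : Matrix (Fin (n+1)) (Fin (n+1)) R) :
    h *ᵥ minorVec (M * h) = h.det • minorVec M := by
  ext i
  have key : consRow (Pi.single i 1) M * h = consRow (h i) (M * h) := by
    ext r c
    refine Fin.cases ?_ (fun r => ?_) r
    · simp only [mul_apply, consRow_zero, Pi.single_apply, ite_mul, one_mul, zero_mul,
        Finset.sum_ite_eq', Finset.mem_univ, if_true]
    · simp only [mul_apply, consRow_succ]
  have := congrArg det key
  rw [det_mul, det_consRow_eq_dotProduct_minorVec, det_consRow_eq_dotProduct_minorVec,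
    single_one_dotProduct] at this
  simp only [Pi.smul_apply, smul_eq_mul, mulVec]
  rw [← this, mul_comm]

/-- The pencil `x a - y b`. -/
noncomputable def pencil {m k : Type*} (a b : Matrix m k R) :
    Matrix m k (MvPolynomial (Fin 2) R) :=
  Matrix.of fun r c => X 0 * C (a r c) - X 1 * C (b r c)

/-- The coefficient matrix of the signed maximal minors of the pencil `x a - y b`. -/
noncomputable def minorCoeff (a b : Matrix (Fin n) (Fin (n+1)) R) :
    Matrix (Fin (n+1)) (Fin (n+1)) R :=
  Matrix.of fun i j => formCoeff (minorVec (pencil a b) i) n j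

theorem pencil_mul_left (g : Matrix (Fin n) (Fin n) R) (a b : Matrix (Fin n) (Fin (n+1)) R) :
    pencil (g * a) (g * b) =
      (g.map C : Matrix (Fin n) (Fin n) (MvPolynomial (Fin 2) R)) * pencil a b := by
  refine Matrix.ext fun r c => ?_
  simp only [pencil, of_apply, mul_apply, map_sum, Finset.mul_sum, ← Finset.sum_sub_distrib,
    Matrix.map_apply, map_mul]
  exact Finset.sum_congr rfl fun _ _ => by ring

theorem pencil_mul_right (h : Matrix (Fin (n+1)) (Fin (n+1)) R)
    (a b : Matrix (Fin n) (Fin (n+1)) R) :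
    pencil (a * h) (b * h) =
      pencil a b * (h.map C : Matrix (Fin (n+1)) (Fin (n+1)) (MvPolynomial (Fin 2) R)) := by
  refine Matrix.ext fun r c => ?_
  simp only [pencil, of_apply, mul_apply, map_sum, Finset.mul_sum, ← Finset.sum_sub_distrib,
    Matrix.map_apply, map_mul]
  exact Finset.sum_congr rfl fun _ _ => by ring

theorem det_map_C {k : Type*} [Fintype k] [DecidableEq k] (g : Matrix k k R) :
    (g.map (C : R → MvPolynomial (Fin 2) R)).det = C g.det :=
  (RingHom.map_det (C : R →+* MvPolynomial (Fin 2) R) g).symm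

theorem minorCoeff_mul_left (g : Matrix (Fin n) (Fin n) R)
    (a b : Matrix (Fin n) (Fin (n+1)) R) :
    minorCoeff (g * a) (g * b) = g.det • minorCoeff a b := by
  ext i j
  simp only [minorCoeff, of_apply, pencil_mul_left, minorVec_mul_left, det_map_C, Matrix.smul_apply,
    Pi.smul_apply, smul_eq_mul, formCoeff, coeff_C_mul]

theorem mul_minorCoeff_mul_right (h : Matrix (Fin (n+1)) (Fin (n+1)) R)
    (a b : Matrix (Fin n) (Fin (n+1)) R) :
    h * minorCoeff (a * h) (b * h) = h.det • minorCoeff a b := by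
  ext i j
  have := congrArg (fun f => formCoeff f n j)
    (congrFun (mulVec_minorVec_mul_right (pencil a b) (h.map C)) i)
  simpa only [minorCoeff, of_apply, pencil_mul_right, det_map_C, Matrix.smul_apply, mul_apply,
    Pi.smul_apply, smul_eq_mul, formCoeff, coeff_C_mul, mulVec, dotProduct, coeff_sum,
    Matrix.map_apply] using this

/-- The matrix `[0 | 1]` of size `n × (n+1)`. -/
def stdLeft (R : Type*) [CommRing R] (n : ℕ) : Matrix (Fin n) (Fin (n+1)) R :=
  Matrix.of fun r c => if c = r.succ then 1 else 0

/-- The matrix `[1 | 0]` of size `n × (n+1)`. -/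
def stdRight (R : Type*) [CommRing R] (n : ℕ) : Matrix (Fin n) (Fin (n+1)) R :=
  Matrix.of fun r c => if c = r.castSucc then 1 else 0

theorem sum_coeff_X_mul_sub_eq_zero (a b : Matrix (Fin n) (Fin (n+1)) R) (r : Fin n) (p q : ℕ) :
    ∑ c, (coeff (Finsupp.single (0 : Fin 2) p + Finsupp.single (1 : Fin 2) q)
        (X 0 * (C (a r c) * minorVec (pencil a b) c)) -
      coeff (Finsupp.single (0 : Fin 2) p + Finsupp.single (1 : Fin 2) q)
        (X 1 * (C (b r c) * minorVec (pencil a b) c))) = 0 := by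
  have := congrArg (coeff (Finsupp.single (0 : Fin 2) p + Finsupp.single (1 : Fin 2) q))
    (congrFun (mulVec_minorVec_self (pencil a b)) r)
  simp only [mulVec, dotProduct, coeff_sum, Pi.zero_apply, coeff_zero] at this
  rw [← this]
  refine Finset.sum_congr rfl fun c _ => ?_
  rw [← coeff_sub]
  congr 1
  simp only [pencil, of_apply]
  ring

theorem coeff_X_zero_mul (f : MvPolynomial (Fin 2) R) (p q : ℕ) :
    coeff (Finsupp.single (0 : Fin 2) (p+1) + Finsupp.single (1 : Fin 2) q) (X 0 * f)
      = coeff (Finsupp.single (0 : Fin 2) p + Finsupp.single (1 : Fin 2) q) f := by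
  rw [show Finsupp.single (0 : Fin 2) (p+1) + Finsupp.single (1 : Fin 2) q
    = Finsupp.single 0 1 + (Finsupp.single (0 : Fin 2) p + Finsupp.single (1 : Fin 2) q) by
      rw [add_comm p, Finsupp.single_add, add_assoc], coeff_X_mul]

theorem coeff_X_one_mul (f : MvPolynomial (Fin 2) R) (p q : ℕ) :
    coeff (Finsupp.single (0 : Fin 2) p + Finsupp.single (1 : Fin 2) (q+1)) (X 1 * f)
      = coeff (Finsupp.single (0 : Fin 2) p + Finsupp.single (1 : Fin 2) q) f := by
  rw [show Finsupp.single (0 : Fin 2) p + Finsupp.single (1 : Fin 2) (q+1)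
    = Finsupp.single 1 1 + (Finsupp.single (0 : Fin 2) p + Finsupp.single (1 : Fin 2) q) by
      rw [add_comm q, Finsupp.single_add, add_left_comm], coeff_X_mul]

theorem coeff_X_zero_mul_zero (f : MvPolynomial (Fin 2) R) (q : ℕ) :
    coeff (Finsupp.single (0 : Fin 2) 0 + Finsupp.single (1 : Fin 2) q) (X 0 * f) = 0 := by
  rw [coeff_X_mul', if_neg]
  simp

theorem coeff_X_one_mul_zero (f : MvPolynomial (Fin 2) R) (p : ℕ) :
    coeff (Finsupp.single (0 : Fin 2) p + Finsupp.single (1 : Fin 2) 0) (X 1 * f) = 0 := by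
  rw [coeff_X_mul', if_neg]
  simp

theorem mul_minorCoeff_zero (a b : Matrix (Fin n) (Fin (n+1)) R) (r : Fin n) :
    (a * minorCoeff a b) r 0 = 0 := by
  have := sum_coeff_X_mul_sub_eq_zero a b r (n+1) 0
  simpa only [coeff_X_zero_mul, coeff_X_one_mul_zero, sub_zero, coeff_C_mul, mul_apply,
    minorCoeff, of_apply, formCoeff, Fin.val_zero, Nat.sub_zero] using this

theorem mul_minorCoeff_last (a b : Matrix (Fin n) (Fin (n+1)) R) (r : Fin n) :
    (b * minorCoeff a b) r (Fin.last n) = 0 := by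
  have := sum_coeff_X_mul_sub_eq_zero a b r 0 (n+1)
  simpa only [coeff_X_zero_mul_zero, coeff_X_one_mul, zero_sub, coeff_C_mul, mul_apply,
    minorCoeff, of_apply, formCoeff, Fin.val_last, Nat.sub_self, Finset.sum_neg_distrib,
    neg_eq_zero] using this

theorem mul_minorCoeff_succ (a b : Matrix (Fin n) (Fin (n+1)) R) (r j : Fin n) :
    (a * minorCoeff a b) r j.succ = (b * minorCoeff a b) r j.castSucc := by
  have := sum_coeff_X_mul_sub_eq_zero a b r (n - (j + 1) + 1) (j + 1)
  simp only [coeff_X_zero_mul, coeff_X_one_mul, coeff_C_mul, Finset.sum_sub_distrib] at this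
  rw [show n - ((j : ℕ) + 1) + 1 = n - j by omega] at this
  simpa only [mul_apply, minorCoeff, of_apply, formCoeff, Fin.val_succ, Fin.val_castSucc]
    using sub_eq_zero.mp this

theorem exists_mul_minorCoeff_eq (a b : Matrix (Fin n) (Fin (n+1)) R) :
    ∃ c : Matrix (Fin n) (Fin n) R,
      a * minorCoeff a b = c * stdLeft R n ∧ b * minorCoeff a b = c * stdRight R n := by
  refine ⟨Matrix.of fun r j => (b * minorCoeff a b) r j.castSucc, ?_, ?_⟩
  · ext r j
    refine Fin.cases ?_ (fun j => ?_) j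
    · rw [mul_minorCoeff_zero]
      simp [mul_apply, stdLeft, (Fin.succ_ne_zero _).symm]
    · rw [mul_minorCoeff_succ, mul_apply (M := Matrix.of _)]
      simp [stdLeft]
  · ext r j
    refine Fin.lastCases ?_ (fun j => ?_) j
    · rw [mul_minorCoeff_last]
      simp [mul_apply, stdRight, (Fin.castSucc_ne_last _).symm]
    · rw [mul_apply (M := Matrix.of _)]
      simp [stdRight]

theorem stdLeft_mul_transpose : stdLeft R n * (stdLeft R n)ᵀ = 1 := by
  ext r s
  simp [mul_apply, stdLeft, one_apply, eq_comm]

end Pencil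

section Field

variable {K : Type*} [Field K] {n : ℕ}

theorem minorVec_pencil_std (i : Fin (n+1)) :
    minorVec (pencil (stdLeft K n) (stdRight K n)) i = X 0 ^ (n - i : ℕ) * X 1 ^ (i : ℕ) := by
  induction i using Fin.induction with
  | zero =>
    have hM : ((pencil (stdLeft K n) (stdRight K n)).submatrix id
        (Fin.succAbove 0)).BlockTriangular OrderDual.toDual := by
      intro r c hrc
      have hrc : r < c := hrc
      have h1 : c ≠ r := hrc.ne'
      have h2 : c.succ ≠ r.castSucc := by
        intro h
        have := congrArg Fin.val h
        simp only [Fin.val_succ, Fin.val_castSucc] at this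
        omega
      simp [pencil, stdLeft, stdRight, h1, h2]
    have hd (r : Fin n) : r.succ ≠ r.castSucc := Fin.castSucc_lt_succ.ne'
    rw [minorVec, Fin.val_zero, det_of_isLowerTriangular _ hM]
    simp [pencil, stdLeft, stdRight, hd]
  | succ i ih =>
    have := congrFun (mulVec_minorVec_self (pencil (stdLeft K n) (stdRight K n))) i
    have hs : X 0 * minorVec (pencil (stdLeft K n) (stdRight K n)) i.succ
        = X 1 * minorVec (pencil (stdLeft K n) (stdRight K n)) i.castSucc := by
      rw [← sub_eq_zero, ← Pi.zero_apply (M := fun _ => MvPolynomial (Fin 2) K) i, ← this]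
      generalize minorVec (pencil (stdLeft K n) (stdRight K n)) = v
      simp [mulVec, dotProduct, pencil, stdLeft, stdRight, sub_mul, Finset.sum_sub_distrib]
    refine mul_left_cancel₀ (X_ne_zero (0 : Fin 2)) ?_
    rw [hs, ih, Fin.val_castSucc, Fin.val_succ,
      show n - (i : ℕ) = n - (i + 1) + 1 by omega]
    ring

theorem minorCoeff_std : minorCoeff (stdLeft K n) (stdRight K n) = 1 := by
  ext i j
  have hX : (X 0 ^ (n - i : ℕ) * X 1 ^ (i : ℕ) : MvPolynomial (Fin 2) K)
      = monomial (Finsupp.single 0 (n - i : ℕ) + Finsupp.single 1 (i : ℕ)) 1 := by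
    rw [X_pow_eq_monomial, X_pow_eq_monomial, monomial_mul, one_mul]
  rw [minorCoeff, of_apply, minorVec_pencil_std, formCoeff, hX, coeff_monomial, one_apply]
  refine if_congr ⟨fun h => ?_, fun h => by rw [h]⟩ rfl rfl
  have := DFunLike.congr_fun h 1
  exact Fin.ext (by simpa using this)

theorem exists_std_form (a b : Matrix (Fin n) (Fin (n+1)) K) (h : (minorCoeff a b).det ≠ 0) :
    ∃ c : Matrix (Fin n) (Fin n) K, c.det = (minorCoeff a b).det ∧
      a * minorCoeff a b = c * stdLeft K n ∧ b * minorCoeff a b = c * stdRight K n := by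
  obtain ⟨c, h1, h2⟩ := exists_mul_minorCoeff_eq a b
  refine ⟨c, ?_, h1, h2⟩
  have h3 := mul_minorCoeff_mul_right (minorCoeff a b) a b
  rw [h1, h2, minorCoeff_mul_left, minorCoeff_std, Matrix.mul_smul, Matrix.mul_one] at h3
  have hne : minorCoeff a b ≠ 0 := by
    intro h0
    rw [h0, det_zero] at h
    exact h rfl
  exact smul_left_injective K hne h3

theorem minorCoeff_conj (g : Matrix (Fin n) (Fin n) K) (h : Matrix (Fin (n+1)) (Fin (n+1)) K)
    (hg : g.det = 1) (hh : h.det = 1) (a b : Matrix (Fin n) (Fin (n+1)) K) :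
    h * minorCoeff (g * a * h) (g * b * h) = minorCoeff a b := by
  rw [mul_minorCoeff_mul_right, hh, one_smul, minorCoeff_mul_left, hg, one_smul]

theorem exists_minorCoeff_det_eq (hn : 1 ≤ n) {l : K} (hl : l ≠ 0) :
    ∃ a b : Matrix (Fin n) (Fin (n+1)) K, (minorCoeff a b).det = l := by
  obtain ⟨m, rfl⟩ : ∃ m, n = m + 1 := ⟨n - 1, by omega⟩
  set c : Matrix (Fin (m+1)) (Fin (m+1)) K := diagonal (Function.update 1 0 l)
  set d : Matrix (Fin (m+1+1)) (Fin (m+1+1)) K := diagonal (Function.update 1 0 l)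
  have hc : c.det = l := by
    simp [c, det_diagonal, Finset.prod_update_of_mem]
  have hd : d.det = l := by
    simp [d, det_diagonal, Finset.prod_update_of_mem]
  refine ⟨c * stdLeft K (m+1) * d⁻¹, c * stdRight K (m+1) * d⁻¹, ?_⟩
  have := mul_minorCoeff_mul_right d⁻¹ (c * stdLeft K (m+1)) (c * stdRight K (m+1))
  rw [minorCoeff_mul_left, minorCoeff_std, smul_smul, hc, det_nonsing_inv, hd, Ring.inverse_eq_inv',
    inv_mul_cancel₀ hl, one_smul] at this
  have h2 := congrArg det this
  rw [det_mul, det_nonsing_inv, hd, Ring.inverse_eq_inv', det_one] at h2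
  field_simp at h2
  exact h2

theorem exists_conj_eq (a b a' b' : Matrix (Fin n) (Fin (n+1)) K) (h : (minorCoeff a b).det ≠ 0)
    (heq : (minorCoeff a' b').det = (minorCoeff a b).det) :
    ∃ (g₁ : Matrix (Fin n) (Fin n) K) (g₂ : Matrix (Fin (n+1)) (Fin (n+1)) K),
      g₁.det = 1 ∧ g₂.det = 1 ∧ g₁ * a * g₂ᵀ = a' ∧ g₁ * b * g₂ᵀ = b' := by
  obtain ⟨c, hc, hca, hcb⟩ := exists_std_form a b h
  obtain ⟨c', hc', hca', hcb'⟩ := exists_std_form a' b' (heq ▸ h)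
  set d := minorCoeff a b
  set d' := minorCoeff a' b'
  have hcu : IsUnit c.det := by rw [hc]; exact h.isUnit
  have hdu' : IsUnit d'.det := by rw [heq]; exact h.isUnit
  refine ⟨c' * c⁻¹, (d * d'⁻¹)ᵀ, ?_, ?_, ?_, ?_⟩
  · rw [det_mul, det_nonsing_inv, hc', heq, hc, Ring.inverse_eq_inv', mul_inv_cancel₀ h]
  · rw [det_transpose, det_mul, det_nonsing_inv, heq, Ring.inverse_eq_inv', mul_inv_cancel₀ h]
  · rw [transpose_transpose, Matrix.mul_assoc, ← Matrix.mul_assoc a, hca, Matrix.mul_assoc c,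
      Matrix.mul_assoc c', nonsing_inv_mul_cancel_left _ _ hcu, ← Matrix.mul_assoc, ← hca',
      mul_nonsing_inv_cancel_right _ _ hdu']
  · rw [transpose_transpose, Matrix.mul_assoc, ← Matrix.mul_assoc b, hcb, Matrix.mul_assoc c,
      Matrix.mul_assoc c', nonsing_inv_mul_cancel_left _ _ hcu, ← Matrix.mul_assoc, ← hcb',
      mul_nonsing_inv_cancel_right _ _ hdu']

theorem eq_one_of_conj_eq (a b : Matrix (Fin n) (Fin (n+1)) K) (h : (minorCoeff a b).det ≠ 0)
    (g₁ : Matrix (Fin n) (Fin n) K) (g₂ : Matrix (Fin (n+1)) (Fin (n+1)) K)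
    (h₁ : g₁.det = 1) (h₂ : g₂.det = 1) (ha : g₁ * a * g₂ᵀ = a) (hb : g₁ * b * g₂ᵀ = b) :
    g₁ = 1 ∧ g₂ = 1 := by
  obtain ⟨c, hc, hca, -⟩ := exists_std_form a b h
  have hd := minorCoeff_conj g₁ g₂ᵀ h₁ (by rwa [det_transpose]) a b
  rw [ha, hb] at hd
  have hg₂ : g₂ᵀ = 1 := by
    have := mul_nonsing_inv_cancel_right (minorCoeff a b) g₂ᵀ h.isUnit
    rwa [hd, mul_nonsing_inv _ h.isUnit, eq_comm] at this
  refine ⟨?_, transpose_eq_one.mp hg₂⟩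
  rw [hg₂, Matrix.mul_one] at ha
  have hg₁ : g₁ * c = c := by
    have := congrArg (fun x => x * minorCoeff a b * (stdLeft K n)ᵀ) ha
    simpa only [Matrix.mul_assoc, hca, stdLeft_mul_transpose, Matrix.mul_one] using this
  have hcu : IsUnit c.det := by rw [hc]; exact h.isUnit
  have := mul_nonsing_inv_cancel_right c g₁ hcu
  rwa [hg₁, mul_nonsing_inv _ hcu, eq_comm] at this

end Field

section Blocks

variable {R : Type*} [CommRing R] {n : ℕ}

/-- The splitting of `Fin (2n+1)` into its first `n` and last `n+1` elements. -/
def blockEquiv (n : ℕ) : Fin n ⊕ Fin (n+1) ≃ Fin (2*n+1) :=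
  finSumFinEquiv.trans (finCongr (by omega))

theorem blockEquiv_inl (i : Fin n) : blockEquiv n (Sum.inl i) = rowIdx n i := by
  ext; simp [blockEquiv, rowIdx]

theorem blockEquiv_inr (i : Fin (n+1)) : blockEquiv n (Sum.inr i) = colIdx n i := by
  ext; simp [blockEquiv, colIdx]

theorem rowIdx_lt (i : Fin n) : (rowIdx n i : ℕ) < n := by simp [rowIdx]

theorem le_colIdx (i : Fin (n+1)) : n ≤ (colIdx n i : ℕ) := by simp [colIdx]

/-- The block-diagonal matrix with the given blocks. -/
def diagBlocks (g₁ : Matrix (Fin n) (Fin n) R) (g₂ : Matrix (Fin (n+1)) (Fin (n+1)) R) :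
    Matrix (Fin (2*n+1)) (Fin (2*n+1)) R :=
  (fromBlocks g₁ 0 0 g₂).submatrix (blockEquiv n).symm (blockEquiv n).symm

/-- The symmetric matrix with top-right block `a` and zero diagonal blocks. -/
def symmBlocks (a : Matrix (Fin n) (Fin (n+1)) R) : Matrix (Fin (2*n+1)) (Fin (2*n+1)) R :=
  (fromBlocks 0 a aᵀ 0).submatrix (blockEquiv n).symm (blockEquiv n).symm

theorem symmBlocks_apply (a : Matrix (Fin n) (Fin (n+1)) R) (r : Fin n) (c : Fin (n+1)) :
    symmBlocks a (rowIdx n r) (colIdx n c) = a r c := by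
  simp [symmBlocks, ← blockEquiv_inl, ← blockEquiv_inr]

theorem symmBlocks_injective :
    Function.Injective (symmBlocks : Matrix (Fin n) (Fin (n+1)) R → _) := by
  intro a b h
  ext r c
  rw [← symmBlocks_apply a, h, symmBlocks_apply]

theorem diagBlocks_one : diagBlocks (1 : Matrix (Fin n) (Fin n) R) 1 = 1 := by
  rw [diagBlocks, fromBlocks_one, submatrix_one_equiv]

theorem diagBlocks_conj (g₁ : Matrix (Fin n) (Fin n) R) (g₂ : Matrix (Fin (n+1)) (Fin (n+1)) R)
    (a : Matrix (Fin n) (Fin (n+1)) R) :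
    diagBlocks g₁ g₂ * symmBlocks a * (diagBlocks g₁ g₂)ᵀ = symmBlocks (g₁ * a * g₂ᵀ) := by
  simp [diagBlocks, symmBlocks, transpose_submatrix, submatrix_mul_equiv, fromBlocks_transpose,
    fromBlocks_multiply, transpose_mul, Matrix.mul_assoc]

theorem sLnn1mem_diagBlocks {g₁ : Matrix (Fin n) (Fin n) R}
    {g₂ : Matrix (Fin (n+1)) (Fin (n+1)) R} (h₁ : g₁.det = 1) (h₂ : g₂.det = 1) :
    SLnn1mem n (diagBlocks g₁ g₂) := by
  refine ⟨fun i j => ?_, ?_, ?_⟩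
  · obtain ⟨i, rfl⟩ := (blockEquiv n).surjective i
    obtain ⟨j, rfl⟩ := (blockEquiv n).surjective j
    rcases i with i | i <;> rcases j with j | j <;>
      simp [diagBlocks, blockEquiv]
  · rw [← h₁]
    congr 1
    ext i j
    simp [diagBlocks, ← blockEquiv_inl]
  · rw [← h₂]
    congr 1
    ext i j
    simp [diagBlocks, ← blockEquiv_inr]

theorem SLnn1mem.exists_diagBlocks {g : Matrix (Fin (2*n+1)) (Fin (2*n+1)) R}
    (hg : SLnn1mem n g) :
    ∃ (g₁ : Matrix (Fin n) (Fin n) R) (g₂ : Matrix (Fin (n+1)) (Fin (n+1)) R),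
      g₁.det = 1 ∧ g₂.det = 1 ∧ g = diagBlocks g₁ g₂ := by
  refine ⟨_, _, hg.2.1, hg.2.2, ?_⟩
  ext i j
  obtain ⟨i, rfl⟩ := (blockEquiv n).surjective i
  obtain ⟨j, rfl⟩ := (blockEquiv n).surjective j
  rcases i with i | i <;> rcases j with j | j <;>
    simp only [diagBlocks, submatrix_apply, Equiv.symm_apply_apply, fromBlocks_apply₁₁,
      fromBlocks_apply₁₂, fromBlocks_apply₂₁, fromBlocks_apply₂₂, of_apply, Matrix.zero_apply] <;>
    simp only [blockEquiv_inl, blockEquiv_inr]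
  · exact hg.1 _ _ (Or.inl ⟨rowIdx_lt i, le_colIdx j⟩)
  · exact hg.1 _ _ (Or.inr ⟨le_colIdx i, rowIdx_lt j⟩)

theorem isSymm_symmBlocks (a : Matrix (Fin n) (Fin (n+1)) R) : (symmBlocks a).IsSymm := by
  simp [IsSymm, symmBlocks, transpose_submatrix, fromBlocks_transpose]

theorem symmBlocks_eq_zero (a : Matrix (Fin n) (Fin (n+1)) R) (i j : Fin (2*n+1))
    (h : ((i : ℕ) < n ∧ (j : ℕ) < n) ∨ (n ≤ (i : ℕ) ∧ n ≤ (j : ℕ))) :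
    symmBlocks a i j = 0 := by
  revert h
  obtain ⟨i, rfl⟩ := (blockEquiv n).surjective i
  obtain ⟨j, rfl⟩ := (blockEquiv n).surjective j
  rcases i with i | i <;> rcases j with j | j <;> simp [symmBlocks, blockEquiv]

theorem wtopmem_symmBlocks (a b : Matrix (Fin n) (Fin (n+1)) R) :
    Wtopmem n (symmBlocks a, symmBlocks b) :=
  ⟨⟨isSymm_symmBlocks a, isSymm_symmBlocks b⟩,
    fun i j h => ⟨symmBlocks_eq_zero a i j h, symmBlocks_eq_zero b i j h⟩⟩

theorem eq_symmBlocks {A : Matrix (Fin (2*n+1)) (Fin (2*n+1)) R} (hA : A.IsSymm)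
    (h : ∀ i j : Fin (2*n+1),
      (((i : ℕ) < n ∧ (j : ℕ) < n) ∨ (n ≤ (i : ℕ) ∧ n ≤ (j : ℕ))) → A i j = 0) :
    A = symmBlocks (Matrix.of fun r c => A (rowIdx n r) (colIdx n c)) := by
  ext i j
  obtain ⟨i, rfl⟩ := (blockEquiv n).surjective i
  obtain ⟨j, rfl⟩ := (blockEquiv n).surjective j
  rcases i with i | i <;> rcases j with j | j <;>
    simp only [symmBlocks, submatrix_apply, Equiv.symm_apply_apply, fromBlocks_apply₁₁,
      fromBlocks_apply₁₂, fromBlocks_apply₂₁, fromBlocks_apply₂₂, of_apply, Matrix.zero_apply,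
      transpose_apply] <;>
    simp only [blockEquiv_inl, blockEquiv_inr]
  · exact h _ _ (Or.inl ⟨rowIdx_lt i, rowIdx_lt j⟩)
  · exact hA.apply _ _
  · exact h _ _ (Or.inr ⟨le_colIdx i, le_colIdx j⟩)

theorem Wtopmem.exists_symmBlocks {w : MPair n R} (hw : Wtopmem n w) :
    ∃ a b : Matrix (Fin n) (Fin (n+1)) R, w = (symmBlocks a, symmBlocks b) :=
  ⟨_, _, Prod.ext (eq_symmBlocks hw.1.1 fun i j h => (hw.2 i j h).1)
    (eq_symmBlocks hw.1.2 fun i j h => (hw.2 i j h).2)⟩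

theorem actPair_diagBlocks (g₁ : Matrix (Fin n) (Fin n) R)
    (g₂ : Matrix (Fin (n+1)) (Fin (n+1)) R) (a b : Matrix (Fin n) (Fin (n+1)) R) :
    actPair (diagBlocks g₁ g₂) (symmBlocks a, symmBlocks b) =
      (symmBlocks (g₁ * a * g₂ᵀ), symmBlocks (g₁ * b * g₂ᵀ)) :=
  Prod.ext (diagBlocks_conj g₁ g₂ a) (diagBlocks_conj g₁ g₂ b)

theorem lambdaInv_symmBlocks (a b : Matrix (Fin n) (Fin (n+1)) R) :
    lambdaInv n (symmBlocks a, symmBlocks b) = (minorCoeff a b).det := by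
  rw [lambdaInv]
  congr 1
  ext i j
  have hC : ((-1) ^ (i : ℕ) : MvPolynomial (Fin 2) R) = C ((-1) ^ (i : ℕ)) := by simp
  simp only [symmBlocks_apply, minorCoeff, of_apply, minorVec, formCoeff, hC, coeff_C_mul]
  rfl

end Blocks

/-- **Prehomogeneity of `(SL_n × SL_{n+1}) ↷ W_N^top` over subfields of `ℂ`.**
The `λ`-invariant is `(SL_n × SL_{n+1})`-invariant; moreover for every subfield `K ⊆ ℂ` and
every `λ₀ ∈ K^×`, the level set `{(A,B) ∈ W_N^top(K) : λ(A,B) = λ₀}` is nonempty, the group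
`(SL_n × SL_{n+1})(K)` acts transitively on it, and all stabilizers are trivial. -/
theorem lambda_level_sets_prehomogeneous (n : ℕ) (hn : 1 ≤ n) (K : Subfield ℂ)
    (lam₀ : K) (hlam₀ : lam₀ ≠ 0) :
    (∀ (g : Matrix (Fin (2*n+1)) (Fin (2*n+1)) K) (w : MPair n K),
        SLnn1mem n g → Wtopmem n w → lambdaInv n (actPair g w) = lambdaInv n w) ∧
    (∃ w : MPair n K, Wtopmem n w ∧ lambdaInv n w = lam₀) ∧
    (∀ w w' : MPair n K, Wtopmem n w → Wtopmem n w' →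
        lambdaInv n w = lam₀ → lambdaInv n w' = lam₀ →
        ∃ g : Matrix (Fin (2*n+1)) (Fin (2*n+1)) K, SLnn1mem n g ∧ actPair g w = w') ∧
    (∀ (g : Matrix (Fin (2*n+1)) (Fin (2*n+1)) K) (w : MPair n K),
        SLnn1mem n g → Wtopmem n w → lambdaInv n w = lam₀ → actPair g w = w → g = 1) := by
  refine ⟨?_, ?_, ?_, ?_⟩
  · intro g w hg hw
    obtain ⟨g₁, g₂, h₁, h₂, rfl⟩ := hg.exists_diagBlocks
    obtain ⟨a, b, rfl⟩ := hw.exists_symmBlocks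
    have := congrArg det (minorCoeff_conj g₁ g₂ᵀ h₁ (by rwa [det_transpose]) a b)
    rw [det_mul, det_transpose, h₂, one_mul] at this
    rw [actPair_diagBlocks, lambdaInv_symmBlocks, lambdaInv_symmBlocks, this]
  · obtain ⟨a, b, h⟩ := exists_minorCoeff_det_eq hn hlam₀
    exact ⟨_, wtopmem_symmBlocks a b, (lambdaInv_symmBlocks a b).trans h⟩
  · intro w w' hw hw' hl hl'
    obtain ⟨a, b, rfl⟩ := hw.exists_symmBlocks
    obtain ⟨a', b', rfl⟩ := hw'.exists_symmBlocks
    rw [lambdaInv_symmBlocks] at hl hl'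
    obtain ⟨g₁, g₂, h₁, h₂, ha, hb⟩ :=
      exists_conj_eq a b a' b' (hl ▸ hlam₀) (hl'.trans hl.symm)
    exact ⟨_, sLnn1mem_diagBlocks h₁ h₂, by rw [actPair_diagBlocks, ha, hb]⟩
  · intro g w hg hw hl hgw
    obtain ⟨g₁, g₂, h₁, h₂, rfl⟩ := hg.exists_diagBlocks
    obtain ⟨a, b, rfl⟩ := hw.exists_symmBlocks
    rw [lambdaInv_symmBlocks] at hl
    rw [actPair_diagBlocks, Prod.mk.injEq, symmBlocks_injective.eq_iff,
      symmBlocks_injective.eq_iff] at hgw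
    obtain ⟨rfl, rfl⟩ := eq_one_of_conj_eq a b (hl ▸ hlam₀) g₁ g₂ h₁ h₂ hgw.1 hgw.2
    exact diagBlocks_one
end
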